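/- arXiv:1302.5984 — 2 statements merged into one kernel-verified Lean document; each statement's English description precedes it below -/
import Mathlib

section
/- For every real number k with 0 < k < 1 and k ≠ √2 − 1, the series ∑_{n=0}^∞ C(2n,n)² · P_n((−k⁴ + 6k³ − 2k + 1)/((k² + 1)(k² + 2k − 1))) · ((k² + 1)(k² + 2k − 1)/(16(k + 1)²))^n · (C₃n³ + C₂n² + C₁n + C₀) converges to 2(k+1)³(k²+1)/π, where C₃ = 4(k−1)²k²(k² + 3k + 4)², C₂ = 12(k − 1)k(k⁶ + 5k⁵ + 10k⁴ + 10k³ + 5k² − 3k + 4), C₁ = 9k⁸ + 36k⁷ + 37k⁶ + 8k⁵ − 9k⁴ − 56k³ + 63k² − 28k + 4, and C₀ = (k² + 2k − 1)²(2k⁴ + 3k² − 2k + 1). -/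
open Real Filter

/-- The Legendre polynomial of degree `n`, given by the explicit formula
`P_n(x) = 2^{-n} ∑_{j=0}^{n} C(n,j)^2 (x-1)^{n-j} (x+1)^j`. -/
noncomputable def legendreP (n : ℕ) (x : ℝ) : ℝ :=
  (2 : ℝ)⁻¹ ^ n *
    ∑ j ∈ Finset.range (n + 1), (n.choose j : ℝ) ^ 2 * (x - 1) ^ (n - j) * (x + 1) ^ j

lemma summable_succ_pow_mul_geometric (d : ℕ) {r : ℝ} (hr0 : 0 ≤ r) (hr : r < 1) :
    Summable (fun n : ℕ => ((n : ℝ) + 1) ^ d * r ^ n) := by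
  rcases hr0.eq_or_lt with rfl | hpos
  · refine summable_of_ne_finset_zero (s := {0}) fun n hn => ?_
    simp only [Finset.mem_singleton] at hn
    simp [zero_pow hn]
  · have h := summable_pow_mul_geometric_of_norm_lt_one d
      (show ‖r‖ < 1 by rwa [Real.norm_of_nonneg hr0])
    have h' := ((summable_nat_add_iff 1).2 h).mul_right r⁻¹
    refine h'.congr fun n => ?_
    rw [pow_succ]
    push_cast
    field_simp

lemma summable_mul_pow_of_abs_le {a : ℕ → ℝ} {C q x : ℝ} {d : ℕ}
    (ha : ∀ n, |a n| ≤ C * ((n : ℝ) + 1) ^ d * q ^ n) (hq : 0 ≤ q) (hx : |x| * q < 1) :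
    Summable (fun n => a n * x ^ n) := by
  refine Summable.of_norm_bounded
    ((summable_succ_pow_mul_geometric d (mul_nonneg (abs_nonneg x) hq) hx).mul_left C) fun n => ?_
  rw [Real.norm_eq_abs, abs_mul, abs_pow]
  calc |a n| * |x| ^ n ≤ (C * ((n : ℝ) + 1) ^ d * q ^ n) * |x| ^ n := by gcongr; exact ha n
    _ = _ := by rw [mul_pow]; ring

lemma hasDerivAt_tsum_mul_pow {a : ℕ → ℝ} {C q x : ℝ} {d : ℕ}
    (ha : ∀ n, |a n| ≤ C * ((n : ℝ) + 1) ^ d * q ^ n) (hq : 0 < q) (hx : |x| * q < 1) :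
    HasDerivAt (fun y => ∑' n, a n * y ^ n) (∑' n, a n * (n * x ^ (n - 1))) x := by
  obtain ⟨r, hxr, hrq⟩ := exists_between ((lt_div_iff₀ hq).2 hx)
  have hr : 0 < r := (abs_nonneg x).trans_lt hxr
  rw [lt_div_iff₀ hq] at hrq
  have hC : 0 ≤ C := by
    have := (abs_nonneg _).trans (ha 0)
    simpa using this
  refine hasDerivAt_tsum_of_isPreconnected
    (g := fun n y => a n * y ^ n) (g' := fun n y => a n * (n * y ^ (n - 1)))
    (u := fun n : ℕ => C * r⁻¹ * (((n : ℝ) + 1) ^ (d + 1) * (r * q) ^ n))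
    (t := Metric.ball 0 r) (y₀ := x)
    ((summable_succ_pow_mul_geometric (d + 1) (by positivity) hrq).mul_left _)
    Metric.isOpen_ball (convex_ball 0 r).isPreconnected
    (fun n y _ => (hasDerivAt_pow n y).const_mul (a n)) (fun n y hy => ?_)
    (by simpa using hxr) (summable_mul_pow_of_abs_le ha hq.le hx) (by simpa using hxr)
  have hy' : |y| ≤ r := by simpa using (Metric.mem_ball.1 hy).le
  rw [Real.norm_eq_abs, abs_mul, abs_mul, abs_pow, Nat.abs_cast]
  rcases n with _ | n
  · simp only [Nat.cast_zero, zero_mul, mul_zero]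
    positivity
  · calc |a (n + 1)| * (((n + 1 : ℕ) : ℝ) * |y| ^ (n + 1 - 1))
        ≤ (C * (((n + 1 : ℕ) : ℝ) + 1) ^ d * q ^ (n + 1)) *
          ((((n + 1 : ℕ) : ℝ) + 1) * r ^ n) := by
          gcongr
          · exact ha _
          · linarith
          · exact pow_le_pow_left₀ (abs_nonneg y) hy' n
      _ = _ := by rw [mul_pow, pow_succ r n]; field_simp; ring

/-- The squared normalized central binomial coefficients `(C(2n,n) / 4^n)^2`. -/
noncomputable def sqCentral (n : ℕ) : ℝ := ((n.centralBinom : ℝ) / 4 ^ n) ^ 2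

lemma sqCentral_zero : sqCentral 0 = 1 := by simp [sqCentral]

lemma sqCentral_succ (n : ℕ) :
    ((n : ℝ) + 1) ^ 2 * sqCentral (n + 1) = ((n : ℝ) + 1 / 2) ^ 2 * sqCentral n := by
  have h : ((n : ℝ) + 1) * (n + 1).centralBinom = 2 * (2 * n + 1) * n.centralBinom := by
    exact_mod_cast Nat.succ_mul_centralBinom_succ n
  unfold sqCentral
  rw [← mul_pow, ← mul_pow]
  congr 1
  rw [mul_div_assoc', h, pow_succ]
  field_simp
  ring

lemma sqCentral_pos (n : ℕ) : 0 < sqCentral n := by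
  have := n.centralBinom_pos
  unfold sqCentral
  positivity

lemma sqCentral_le_one (n : ℕ) : sqCentral n ≤ 1 := by
  induction n with
  | zero => exact sqCentral_zero.le
  | succ n ih =>
    have h := sqCentral_succ n
    have h1 : ((n : ℝ) + 1 / 2) ^ 2 * sqCentral n ≤ ((n : ℝ) + 1) ^ 2 * 1 := by
      have := (sqCentral_pos n).le
      gcongr
      norm_num
    have h2 : (0 : ℝ) < ((n : ℝ) + 1) ^ 2 := by positivity
    rw [← h] at h1
    exact le_of_mul_le_mul_left h1 h2

lemma sqCentral_eq_inv_wallis (n : ℕ) :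
    sqCentral n = ((2 * (n : ℝ) + 1) * Real.Wallis.W n)⁻¹ := by
  induction n with
  | zero => simp [sqCentral_zero, Real.Wallis.W]
  | succ n ih =>
    have h := sqCentral_succ n
    have hW := Real.Wallis.W_pos n
    rw [ih] at h
    rw [Real.Wallis.W_succ, ← mul_right_inj' (show ((n : ℝ) + 1) ^ 2 ≠ 0 by positivity), h]
    push_cast
    field_simp
    ring

lemma tendsto_mul_sqCentral :
    Tendsto (fun n : ℕ => (n : ℝ) * sqCentral n) atTop (nhds (1 / π)) := by
  have h1 : Tendsto (fun n : ℕ => (n : ℝ) / (n + 1 / 2)) atTop (nhds 1) :=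
    tendsto_natCast_div_add_atTop (1 / 2 : ℝ)
  have h2 := (h1.div_const 2).div Real.Wallis.tendsto_W_nhds_pi_div_two (by positivity)
  have h3 : (1 : ℝ) / 2 / (π / 2) = 1 / π := by field_simp
  rw [h3] at h2
  refine h2.congr fun n => ?_
  have hW := Real.Wallis.W_pos n
  rw [sqCentral_eq_inv_wallis]
  simp only [Pi.div_apply]
  field_simp

lemma tendsto_sqCentral : Tendsto sqCentral atTop (nhds 0) := by
  have h := tendsto_mul_sqCentral.mul (tendsto_inv_atTop_nhds_zero_nat (𝕜 := ℝ))
  rw [mul_zero] at h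
  refine h.congr' ?_
  filter_upwards [eventually_gt_atTop 0] with n hn
  have : (n : ℝ) ≠ 0 := by positivity
  field_simp

lemma tendsto_one_sub_mul_tsum {c : ℕ → ℝ} {C l : ℝ} (hc : ∀ n, |c n| ≤ C)
    (h : Tendsto c atTop (nhds l)) :
    Tendsto (fun x => (1 - x) * ∑' n, c n * x ^ n) (nhdsWithin 1 (Set.Iio 1)) (nhds l) := by
  let f : ℕ → ℝ := fun n => c n - if n = 0 then 0 else c (n - 1)
  have hf : ∀ n, ∑ i ∈ Finset.range (n + 1), f i = c n := by
    intro n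
    induction n with
    | zero => simp [f]
    | succ n ih => rw [Finset.sum_range_succ, ih]; simp [f]
  have hlim : Tendsto (fun n => ∑ i ∈ Finset.range n, f i) atTop (nhds l) := by
    rw [← tendsto_add_atTop_iff_nat 1]
    simpa only [hf] using h
  refine (Real.tendsto_tsum_powerSeries_nhdsWithin_lt hlim).congr' ?_
  have h0 : ∀ᶠ x : ℝ in nhdsWithin 1 (Set.Iio 1), 0 < x :=
    nhdsWithin_le_nhds (lt_mem_nhds one_pos)
  filter_upwards [h0, self_mem_nhdsWithin] with x hx0 hx1
  have hx1 : x < 1 := hx1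
  have hs : Summable (fun n => c n * x ^ n) :=
    summable_mul_pow_of_abs_le (q := 1) (d := 0) (C := C) (by simpa using hc) zero_le_one
      (by rw [abs_of_pos hx0]; linarith)
  have hs1 : Summable (fun n => if n = 0 then 0 else c (n - 1) * x ^ n) := by
    rw [← summable_nat_add_iff 1]
    refine (hs.mul_left x).congr fun n => ?_
    simp [pow_succ]
    ring
  have hshift : ∑' n, (if n = 0 then 0 else c (n - 1) * x ^ n) = x * ∑' n, c n * x ^ n := by
    rw [hs1.tsum_eq_zero_add, ← tsum_mul_left]
    simp only [if_true, zero_add]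
    refine tsum_congr fun n => ?_
    simp [pow_succ]
    ring
  have hfx : ∀ n, f n * x ^ n = c n * x ^ n - if n = 0 then 0 else c (n - 1) * x ^ n := by
    intro n
    by_cases hn : n = 0 <;> simp [f, hn]
    ring
  simp_rw [hfx]
  rw [hs.tsum_sub hs1, hshift]
  ring

/-- The hypergeometric function `₂F₁(1/2, 1/2; 1; x)`, which is `2 / π` times the complete
elliptic integral of the first kind with parameter `x`. -/
noncomputable def ellF (x : ℝ) : ℝ := ∑' n, sqCentral n * x ^ n

/-- The derivative of `ellF` on `(-1, 1)`. -/
noncomputable def ellF' (x : ℝ) : ℝ := ∑' n : ℕ, ((n : ℝ) + 1) * sqCentral (n + 1) * x ^ n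

/-- The function `x (1 - x) ellF' x`. -/
noncomputable def ellG (x : ℝ) : ℝ := x * (1 - x) * ellF' x

lemma abs_sqCentral_le (n : ℕ) : |sqCentral n| ≤ 1 := by
  rw [abs_of_pos (sqCentral_pos n)]
  exact sqCentral_le_one n

lemma summable_ellF {x : ℝ} (hx : |x| < 1) : Summable (fun n => sqCentral n * x ^ n) :=
  summable_mul_pow_of_abs_le (q := 1) (d := 0) (C := 1) (by simpa using abs_sqCentral_le)
    zero_le_one (by linarith)

lemma abs_succ_mul_sqCentral_le (n : ℕ) :
    |((n : ℝ) + 1) * sqCentral (n + 1)| ≤ 1 * ((n : ℝ) + 1) ^ 1 * 1 ^ n := by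
  rw [abs_mul, abs_of_pos (by positivity : (0 : ℝ) < (n : ℝ) + 1)]
  have := abs_sqCentral_le (n + 1)
  rw [one_pow, mul_one, one_mul, pow_one]
  exact mul_le_of_le_one_right (by positivity) this

lemma tsum_mul_natCast_mul_pow_pred {a : ℕ → ℝ} {C x : ℝ} {d : ℕ}
    (ha : ∀ n, |a n| ≤ C * ((n : ℝ) + 1) ^ d * 1 ^ n) (hx : |x| < 1) :
    ∑' n, a n * (n * x ^ (n - 1)) = ∑' n : ℕ, ((n : ℝ) + 1) * a (n + 1) * x ^ n := by
  have hs : Summable (fun n : ℕ => ((n : ℝ) + 1) * a (n + 1) * x ^ n) := by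
    have hC : 0 ≤ C := by
      have := (abs_nonneg _).trans (ha 0)
      simpa using this
    refine summable_mul_pow_of_abs_le (C := C * 2 ^ d) (d := d + 1) (q := 1) (fun n => ?_)
      zero_le_one (by linarith)
    rw [abs_mul, abs_of_pos (by positivity : (0 : ℝ) < (n : ℝ) + 1)]
    have h := ha (n + 1)
    push_cast at h
    have h2 : ((n : ℝ) + 1 + 1) ^ d ≤ (2 * ((n : ℝ) + 1)) ^ d := by
      gcongr
      linarith [(Nat.cast_nonneg n : (0 : ℝ) ≤ n)]
    calc ((n : ℝ) + 1) * |a (n + 1)|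
        ≤ ((n : ℝ) + 1) * (C * (2 * ((n : ℝ) + 1)) ^ d) := by
          gcongr
          refine h.trans ?_
          rw [one_pow, mul_one]
          gcongr
      _ = _ := by rw [mul_pow]; ring
  rw [Summable.tsum_eq_zero_add]
  · simp only [Nat.cast_zero, zero_mul, mul_zero, zero_add, Nat.add_sub_cancel]
    refine tsum_congr fun n => ?_
    push_cast
    ring
  · rw [← summable_nat_add_iff 1]
    refine hs.congr fun n => ?_
    simp only [Nat.add_sub_cancel]
    push_cast
    ring

lemma hasDerivAt_ellF {x : ℝ} (hx : |x| < 1) : HasDerivAt ellF (ellF' x) x := by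
  have ha : ∀ n, |sqCentral n| ≤ 1 * ((n : ℝ) + 1) ^ 0 * 1 ^ n := by simpa using abs_sqCentral_le
  have h := hasDerivAt_tsum_mul_pow ha one_pos (by linarith)
  rwa [tsum_mul_natCast_mul_pow_pred ha hx] at h

lemma hasDerivAt_ellG {x : ℝ} (hx : |x| < 1) : HasDerivAt ellG (ellF x / 4) x := by
  have ha : ∀ n : ℕ, |(n : ℝ) * sqCentral n| ≤ 1 * ((n : ℝ) + 1) ^ 1 * 1 ^ n := by
    intro n
    rw [abs_mul, Nat.abs_cast, one_pow, mul_one, one_mul, pow_one]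
    nlinarith [abs_sqCentral_le n, abs_nonneg (sqCentral n), (Nat.cast_nonneg n : (0 : ℝ) ≤ n)]
  have ha2 : ∀ n : ℕ, |(n : ℝ) ^ 2 * sqCentral n| ≤ 1 * ((n : ℝ) + 1) ^ 2 * 1 ^ n := by
    intro n
    rw [abs_mul, abs_of_nonneg (by positivity : (0 : ℝ) ≤ (n : ℝ) ^ 2), one_pow, mul_one, one_mul]
    nlinarith [abs_sqCentral_le n, abs_nonneg (sqCentral n), (Nat.cast_nonneg n : (0 : ℝ) ≤ n)]
  have hlt : |x| * 1 < 1 := by linarith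
  have hs0 := summable_ellF hx
  have hs1 := summable_mul_pow_of_abs_le ha zero_le_one hlt
  have hs2 := summable_mul_pow_of_abs_le ha2 zero_le_one hlt
  have heq : ∀ y : ℝ, |y| < 1 → ∑' n : ℕ, (n : ℝ) * sqCentral n * y ^ n = y * ellF' y := by
    intro y hy
    rw [(summable_mul_pow_of_abs_le ha zero_le_one (by linarith)).tsum_eq_zero_add, ellF',
      ← tsum_mul_left]
    simp only [Nat.cast_zero, zero_mul, zero_add]
    refine tsum_congr fun n => ?_
    push_cast
    ring
  have hd := hasDerivAt_tsum_mul_pow ha one_pos hlt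
  rw [tsum_mul_natCast_mul_pow_pred ha hx] at hd
  have hM : ∑' n : ℕ, ((n : ℝ) + 1) * (((n + 1 : ℕ) : ℝ) * sqCentral (n + 1)) * x ^ n =
      ∑' n : ℕ, (n : ℝ) ^ 2 * sqCentral n * x ^ n + ∑' n : ℕ, (n : ℝ) * sqCentral n * x ^ n +
        ellF x / 4 := by
    rw [ellF, ← tsum_div_const, ← hs2.tsum_add hs1, ← (hs2.add hs1).tsum_add (hs0.div_const 4)]
    refine tsum_congr fun n => ?_
    have := sqCentral_succ n
    push_cast
    linear_combination x ^ n * this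
  have hx2 : ∑' n : ℕ, (n : ℝ) ^ 2 * sqCentral n * x ^ n =
      x * ∑' n : ℕ, ((n : ℝ) + 1) * (((n + 1 : ℕ) : ℝ) * sqCentral (n + 1)) * x ^ n := by
    rw [hs2.tsum_eq_zero_add, ← tsum_mul_left]
    simp only [Nat.cast_zero, ne_eq, OfNat.ofNat_ne_zero, not_false_eq_true, zero_pow, zero_mul,
      zero_add]
    refine tsum_congr fun n => ?_
    push_cast
    ring
  have hmul := ((hasDerivAt_id x).const_sub 1).mul hd
  have hev : ellG =ᶠ[nhds x]
      (fun y => 1 - id y) * fun y => ∑' n : ℕ, (n : ℝ) * sqCentral n * y ^ n := by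
    filter_upwards [continuous_abs.continuousAt.eventually_lt continuousAt_const hx] with y hy
    simp only [Pi.mul_apply, id]
    rw [heq y hy, ellG]
    ring
  refine (hmul.congr_of_eventuallyEq hev).congr_deriv ?_
  simp only [id]
  linear_combination hM + hx2

lemma ellF_zero : ellF 0 = 1 := by
  rw [ellF, tsum_eq_single 0 fun n hn => by simp [hn]]
  simp [sqCentral_zero]

lemma ellF_mono {x y : ℝ} (hx : 0 ≤ x) (hxy : x ≤ y) (hy : y < 1) : ellF x ≤ ellF y := by
  refine Summable.tsum_le_tsum (fun n => ?_)
    (summable_ellF (by rw [abs_of_nonneg hx]; linarith))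
    (summable_ellF (by rw [abs_of_nonneg (hx.trans hxy)]; linarith))
  have := (sqCentral_pos n).le
  gcongr

lemma one_le_ellF {x : ℝ} (hx : 0 ≤ x) (hx1 : x < 1) : 1 ≤ ellF x := by
  rw [← ellF_zero]
  exact ellF_mono le_rfl hx hx1

lemma tendsto_one_sub_mul_ellF :
    Tendsto (fun x => (1 - x) * ellF x) (nhdsWithin 1 (Set.Iio 1)) (nhds 0) :=
  tendsto_one_sub_mul_tsum abs_sqCentral_le tendsto_sqCentral

lemma tendsto_ellG : Tendsto ellG (nhdsWithin 1 (Set.Iio 1)) (nhds (1 / π)) := by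
  have hlim : Tendsto (fun n : ℕ => ((n : ℝ) + 1) * sqCentral (n + 1)) atTop (nhds (1 / π)) := by
    simpa using (tendsto_add_atTop_iff_nat 1).2 tendsto_mul_sqCentral
  obtain ⟨C, hC⟩ := hlim.abs.bddAbove_range
  have h := tendsto_one_sub_mul_tsum (fun n => hC ⟨n, rfl⟩) hlim
  have hid : Tendsto (fun x : ℝ => x) (nhdsWithin 1 (Set.Iio 1)) (nhds 1) :=
    tendsto_id.mono_left nhdsWithin_le_nhds
  have h2 := hid.mul h
  rw [one_mul] at h2
  refine h2.congr fun x => ?_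
  rw [ellG, ellF']
  ring

/-- The binary form `∑ C(n,j)^2 A^(n-j) B^j`. -/
noncomputable def sqBinomForm (n : ℕ) (A B : ℝ) : ℝ :=
  ∑ j ∈ Finset.range (n + 1), (n.choose j : ℝ) ^ 2 * A ^ (n - j) * B ^ j

lemma sum_sub_sq_mul_sqBinomForm (m : ℕ) (A B : ℝ) :
    ∑ j ∈ Finset.range (m + 1 + 1), ((m + 1).choose j : ℝ) ^ 2 * (((m + 1 : ℕ) : ℝ) - j) ^ 2 *
      A ^ (m + 1 - j) * B ^ j = ((m : ℝ) + 1) ^ 2 * (A * sqBinomForm m A B) := by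
  rw [Finset.sum_range_succ, sqBinomForm, Finset.mul_sum, Finset.mul_sum]
  simp only [sub_self, ne_eq, OfNat.ofNat_ne_zero, not_false_eq_true, zero_pow, mul_zero, zero_mul,
    add_zero]
  refine Finset.sum_congr rfl fun j hj => ?_
  have hj : j ≤ m := Nat.lt_succ_iff.1 (Finset.mem_range.1 hj)
  have h : ((m + 1).choose j : ℝ) * (((m + 1 : ℕ) : ℝ) - j) = (m.choose j : ℝ) * (m + 1) := by
    have := Nat.choose_mul_succ_eq m j
    rw [← Nat.cast_sub (by omega)]
    exact_mod_cast this.symm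
  rw [← mul_pow, h, show m + 1 - j = (m - j) + 1 by omega]
  ring

lemma sum_sq_mul_sqBinomForm (m : ℕ) (A B : ℝ) :
    ∑ j ∈ Finset.range (m + 1 + 1), ((m + 1).choose j : ℝ) ^ 2 * (j : ℝ) ^ 2 *
      A ^ (m + 1 - j) * B ^ j = ((m : ℝ) + 1) ^ 2 * (B * sqBinomForm m A B) := by
  rw [Finset.sum_range_succ', sqBinomForm, Finset.mul_sum, Finset.mul_sum]
  simp only [Nat.cast_zero, ne_eq, OfNat.ofNat_ne_zero, not_false_eq_true, zero_pow, mul_zero,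
    zero_mul, add_zero]
  refine Finset.sum_congr rfl fun j _ => ?_
  have h : ((m + 1).choose (j + 1) : ℝ) * ((j + 1 : ℕ) : ℝ) = (m + 1) * (m.choose j : ℝ) := by
    have := Nat.add_one_mul_choose_eq m j
    exact_mod_cast this.symm
  rw [← mul_pow, h, show m + 1 - (j + 1) = m - j by omega]
  ring

lemma sqBinomForm_nonneg {A B : ℝ} (hA : 0 ≤ A) (hB : 0 ≤ B) (n : ℕ) : 0 ≤ sqBinomForm n A B :=
  Finset.sum_nonneg fun j _ => by positivity

lemma sqBinomForm_le {A B : ℝ} (hA : 0 ≤ A) (hB : 0 ≤ B) (n : ℕ) :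
    sqBinomForm n A B ≤ ((√A + √B) ^ 2) ^ n := by
  have h : sqBinomForm n A B =
      ∑ j ∈ Finset.range (n + 1), (√B ^ j * √A ^ (n - j) * (n.choose j : ℝ)) ^ 2 := by
    refine Finset.sum_congr rfl fun j _ => ?_
    rw [mul_pow, mul_pow, ← pow_mul, ← pow_mul, mul_comm j 2, mul_comm (n - j) 2, pow_mul, pow_mul,
      Real.sq_sqrt hA, Real.sq_sqrt hB]
    ring
  rw [h, ← pow_mul, mul_comm 2 n, pow_mul, add_comm (√A), add_pow]
  exact Finset.sum_sq_le_sq_sum_of_nonneg fun j _ => by positivity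

lemma sqBinomForm_mul (n : ℕ) (t A B : ℝ) :
    sqBinomForm n (t * A) (t * B) = t ^ n * sqBinomForm n A B := by
  rw [sqBinomForm, sqBinomForm, Finset.mul_sum]
  refine Finset.sum_congr rfl fun j hj => ?_
  have hj : j ≤ n := Nat.lt_succ_iff.1 (Finset.mem_range.1 hj)
  rw [mul_pow, mul_pow, ← Nat.sub_add_cancel hj, pow_add, Nat.add_sub_cancel]
  ring

lemma sqBinomForm_zero_left (n : ℕ) (B : ℝ) : sqBinomForm n 0 B = B ^ n := by
  rw [sqBinomForm, Finset.sum_range_succ, Finset.sum_eq_zero]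
  · simp
  · intro j hj
    rw [zero_pow (by have := Finset.mem_range.1 hj; omega)]
    ring

/-- The general term `r_n(x, y)` of Bailey's product expansion. -/
noncomputable def baileyTerm (n : ℕ) (y x : ℝ) : ℝ :=
  sqCentral n * sqBinomForm n (x * (1 - y)) (y * (1 - x))

/-- The image of `baileyTerm` under the derivation `x (1 - x) d/dx`. -/
noncomputable def baileyTermD (n : ℕ) (y x : ℝ) : ℝ :=
  sqCentral n * ∑ j ∈ Finset.range (n + 1), (n.choose j : ℝ) ^ 2 * ((n : ℝ) - j - n * x) *
    (x * (1 - y)) ^ (n - j) * (y * (1 - x)) ^ j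

lemma hasDerivAt_mul_pow_mul_pow (i j : ℕ) (x y : ℝ) (hx0 : x ≠ 0) (hx1 : 1 - x ≠ 0) :
    HasDerivAt (fun x => (x * (1 - y)) ^ i * (y * (1 - x)) ^ j)
      ((i - ((i : ℝ) + j) * x) / (x * (1 - x)) *
        ((x * (1 - y)) ^ i * (y * (1 - x)) ^ j)) x := by
  have h1 := ((hasDerivAt_id x).mul_const (1 - y)).pow i
  have h2 := (((hasDerivAt_id x).const_sub 1).const_mul y).pow j
  refine (h1.mul h2).congr_deriv ?_
  simp only [id, Pi.pow_apply]
  have e1 : ((x * (1 - y)) ^ (i - 1)) * (1 - y) * i = i / x * (x * (1 - y)) ^ i := by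
    rcases i with _ | i
    · simp
    · rw [Nat.add_sub_cancel, pow_succ]; field_simp
  have e2 : ((y * (1 - x)) ^ (j - 1)) * y * j = j / (1 - x) * (y * (1 - x)) ^ j := by
    rcases j with _ | j
    · simp
    · rw [Nat.add_sub_cancel, pow_succ]; field_simp
  have e3 : (i - ((i : ℝ) + j) * x) / (x * (1 - x)) = i / x - j / (1 - x) := by
    field_simp
    ring
  rw [e3]
  linear_combination (y * (1 - x)) ^ j * e1 - (x * (1 - y)) ^ i * e2

lemma hasDerivAt_baileyTerm (n : ℕ) (y x : ℝ) (hx0 : x ≠ 0) (hx1 : 1 - x ≠ 0) :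
    HasDerivAt (baileyTerm n y) (baileyTermD n y x / (x * (1 - x))) x := by
  have h := (HasDerivAt.fun_sum (u := Finset.range (n + 1)) fun j _ =>
    (hasDerivAt_mul_pow_mul_pow (n - j) j x y hx0 hx1).const_mul
      ((n.choose j : ℝ) ^ 2)).const_mul (sqCentral n)
  refine (h.congr_of_eventuallyEq (Eventually.of_forall fun z => ?_)).congr_deriv ?_
  · simp only [baileyTerm, sqBinomForm, mul_assoc]
  · rw [baileyTermD, mul_div_assoc, Finset.sum_div]
    congr 1
    refine Finset.sum_congr rfl fun j hj => ?_
    have hj : j ≤ n := Nat.lt_succ_iff.1 (Finset.mem_range.1 hj)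
    rw [Nat.cast_sub hj]
    ring

lemma hasDerivAt_baileyTermD_aux (n : ℕ) (y x : ℝ) (hx0 : x ≠ 0) (hx1 : 1 - x ≠ 0) :
    HasDerivAt (baileyTermD n y)
      (sqCentral n * ∑ j ∈ Finset.range (n + 1), (n.choose j : ℝ) ^ 2 *
        (((n : ℝ) - j) ^ 2 * (1 - x) + j ^ 2 * x - ((n : ℝ) ^ 2 + n) * (x * (1 - x))) *
        (x * (1 - y)) ^ (n - j) * (y * (1 - x)) ^ j / (x * (1 - x))) x := by
  have h := (HasDerivAt.fun_sum (u := Finset.range (n + 1)) fun j _ =>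
    (((hasDerivAt_id x).const_mul (n : ℝ)).const_sub ((n : ℝ) - j)).mul
    ((hasDerivAt_mul_pow_mul_pow (n - j) j x y hx0 hx1).const_mul
      ((n.choose j : ℝ) ^ 2))).const_mul (sqCentral n)
  refine (h.congr_of_eventuallyEq (Eventually.of_forall fun z => ?_)).congr_deriv ?_
  · simp only [baileyTermD, Pi.mul_apply, id]
    congr 1
    refine Finset.sum_congr rfl fun j _ => ?_
    ring
  · congr 1
    refine Finset.sum_congr rfl fun j hj => ?_
    have hj : j ≤ n := Nat.lt_succ_iff.1 (Finset.mem_range.1 hj)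
    rw [Nat.cast_sub hj]
    simp only [id]
    field_simp
    ring

lemma hasDerivAt_baileyTermD_zero (y x : ℝ) : HasDerivAt (baileyTermD 0 y) 0 x := by
  refine (hasDerivAt_const x (0 : ℝ)).congr_of_eventuallyEq (Eventually.of_forall fun z => ?_)
  simp [baileyTermD]

lemma hasDerivAt_baileyTermD_succ (m : ℕ) (y x : ℝ) (hx0 : x ≠ 0) (hx1 : 1 - x ≠ 0) :
    HasDerivAt (baileyTermD (m + 1) y)
      (((m : ℝ) + 1 / 2) ^ 2 * baileyTerm m y x -
        (((m : ℝ) + 1 + 1 / 2) ^ 2 - 1 / 4) * baileyTerm (m + 1) y x) x := by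
  refine (hasDerivAt_baileyTermD_aux (m + 1) y x hx0 hx1).congr_deriv ?_
  have h1 := sum_sub_sq_mul_sqBinomForm m (x * (1 - y)) (y * (1 - x))
  have h2 := sum_sq_mul_sqBinomForm m (x * (1 - y)) (y * (1 - x))
  have h3 : sqBinomForm (m + 1) (x * (1 - y)) (y * (1 - x)) =
    ∑ j ∈ Finset.range (m + 1 + 1), ((m + 1).choose j : ℝ) ^ 2 *
      (x * (1 - y)) ^ (m + 1 - j) * (y * (1 - x)) ^ j := rfl
  have hsum : ∑ j ∈ Finset.range (m + 1 + 1), ((m + 1).choose j : ℝ) ^ 2 *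
        ((((m + 1 : ℕ) : ℝ) - j) ^ 2 * (1 - x) + j ^ 2 * x -
          (((m + 1 : ℕ) : ℝ) ^ 2 + (m + 1 : ℕ)) * (x * (1 - x))) *
        (x * (1 - y)) ^ (m + 1 - j) * (y * (1 - x)) ^ j / (x * (1 - x)) =
      ((m : ℝ) + 1) ^ 2 * sqBinomForm m (x * (1 - y)) (y * (1 - x)) -
        (((m : ℝ) + 1 + 1 / 2) ^ 2 - 1 / 4) *
          sqBinomForm (m + 1) (x * (1 - y)) (y * (1 - x)) := by
    rw [← Finset.sum_div, div_eq_iff (mul_ne_zero hx0 hx1)]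
    have e : ((m : ℝ) + 1) ^ 2 * sqBinomForm m (x * (1 - y)) (y * (1 - x)) * (x * (1 - x)) =
      (1 - x) * (((m : ℝ) + 1) ^ 2 * (x * (1 - y) * sqBinomForm m (x * (1 - y)) (y * (1 - x)))) +
      x * (((m : ℝ) + 1) ^ 2 * (y * (1 - x) * sqBinomForm m (x * (1 - y)) (y * (1 - x)))) := by
      ring
    rw [sub_mul, e, ← h1, ← h2, h3, mul_assoc (_ - _) (Finset.sum _ _), mul_comm (Finset.sum _ _)
      (x * (1 - x)), Finset.mul_sum, Finset.mul_sum, Finset.mul_sum, Finset.mul_sum,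
      ← Finset.sum_add_distrib, ← Finset.sum_sub_distrib]
    refine Finset.sum_congr rfl fun j _ => ?_
    push_cast
    ring
  rw [hsum, baileyTerm, baileyTerm]
  linear_combination sqBinomForm m (x * (1 - y)) (y * (1 - x)) * sqCentral_succ m

lemma hasDerivAt_ellF_of_mem {x : ℝ} (hx0 : 0 < x) (hx1 : x < 1) :
    HasDerivAt ellF (ellG x / (x * (1 - x))) x := by
  have h1 : 1 - x ≠ 0 := by linarith
  refine (hasDerivAt_ellF (by rwa [abs_of_pos hx0])).congr_deriv ?_
  rw [ellG]
  field_simp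

lemma hasDerivAt_sum_baileyTermD (N : ℕ) (y x : ℝ) (hx0 : x ≠ 0) (hx1 : 1 - x ≠ 0) :
    HasDerivAt (fun s => ∑ n ∈ Finset.range (N + 1), baileyTermD n y s)
      ((∑ n ∈ Finset.range (N + 1), baileyTerm n y x) / 4 -
        ((N : ℝ) + 1 / 2) ^ 2 * baileyTerm N y x) x := by
  induction N with
  | zero =>
    simp only [zero_add, Finset.sum_range_one]
    refine (hasDerivAt_baileyTermD_zero y x).congr_deriv ?_
    push_cast
    ring
  | succ N ih =>
    simp_rw [Finset.sum_range_succ _ (N + 1)]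
    refine (ih.add (hasDerivAt_baileyTermD_succ N y x hx0 hx1)).congr_deriv ?_
    push_cast
    ring

lemma sqrt_add_sqrt_sq_lt_one {x y : ℝ} (hx : 0 ≤ x) (hy : 0 ≤ y) (hxy : x + y < 1) :
    (√(x * (1 - y)) + √(y * (1 - x))) ^ 2 < 1 := by
  have hA : 0 ≤ x * (1 - y) := mul_nonneg hx (by linarith)
  have hB : 0 ≤ y * (1 - x) := mul_nonneg hy (by linarith)
  have hxy0 := mul_nonneg hx hy
  have h : (√(x * (1 - y)) * √(y * (1 - x))) < (1 - x - y + 2 * (x * y)) / 2 := by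
    refine lt_of_pow_lt_pow_left₀ 2 (by linarith) ?_
    rw [mul_pow, Real.sq_sqrt hA, Real.sq_sqrt hB]
    have : 0 < (1 - x - y) ^ 2 := pow_pos (by linarith) 2
    nlinarith
  rw [add_sq, Real.sq_sqrt hA, Real.sq_sqrt hB]
  nlinarith

lemma baileyTerm_nonneg {x y : ℝ} (hx : 0 ≤ x) (hy : 0 ≤ y) (hxy : x + y < 1) (n : ℕ) :
    0 ≤ baileyTerm n y x :=
  mul_nonneg (sqCentral_pos n).le (sqBinomForm_nonneg (mul_nonneg hx (by linarith))
    (mul_nonneg hy (by linarith)) n)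

lemma baileyTerm_le {x y q : ℝ} (hx : 0 ≤ x) (hy : 0 ≤ y) (hxy : x + y < 1)
    (hq : (√(x * (1 - y)) + √(y * (1 - x))) ^ 2 ≤ q) (n : ℕ) :
    baileyTerm n y x ≤ q ^ n := by
  have hA : 0 ≤ x * (1 - y) := mul_nonneg hx (by linarith)
  have hB : 0 ≤ y * (1 - x) := mul_nonneg hy (by linarith)
  calc baileyTerm n y x ≤ 1 * sqBinomForm n (x * (1 - y)) (y * (1 - x)) :=
        mul_le_mul_of_nonneg_right (sqCentral_le_one n) (sqBinomForm_nonneg hA hB n)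
    _ ≤ ((√(x * (1 - y)) + √(y * (1 - x))) ^ 2) ^ n := by
        rw [one_mul]; exact sqBinomForm_le hA hB n
    _ ≤ q ^ n := pow_le_pow_left₀ (by positivity) hq n

lemma abs_sum_baileyTerm_div_sub_le {x y q : ℝ} (hx : 0 < x) (hy : 0 ≤ y) (hxy : x + y < 1)
    (hq : ∀ s ∈ Set.Icc 0 x, (√(s * (1 - y)) + √(y * (1 - s))) ^ 2 ≤ q) (N : ℕ) :
    |(∑ n ∈ Finset.range (N + 1), baileyTerm n y x) / ellF x -
      ∑ n ∈ Finset.range (N + 1), sqCentral n * y ^ n| ≤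
      ((N : ℝ) + 1 / 2) ^ 2 * q ^ N * ellF x / (1 - x) * x := by
  set R : ℝ → ℝ := fun s => ∑ n ∈ Finset.range (N + 1), baileyTerm n y s with hR
  set E : ℝ → ℝ := fun s => ∑ n ∈ Finset.range (N + 1), baileyTermD n y s with hE
  set K : ℝ := ((N : ℝ) + 1 / 2) ^ 2 * q ^ N * ellF x with hK
  have hx1 : x < 1 := by linarith
  have hq0 : 0 ≤ q := (by positivity : (0 : ℝ) ≤ _).trans (hq 0 ⟨le_rfl, hx.le⟩)
  have habs : ∀ s ∈ Set.Icc 0 x, |s| < 1 := fun s hs => by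
    rw [abs_of_nonneg hs.1]; linarith [hs.2]
  have hFx := one_le_ellF hx.le hx1
  have hF0 : ∀ s ∈ Set.Icc 0 x, 1 ≤ ellF s := fun s hs => one_le_ellF hs.1 (by linarith [hs.2])
  have hRc : Continuous R := by
    simp only [hR, baileyTerm, sqBinomForm]
    fun_prop
  have hEc : Continuous E := by
    simp only [hE, baileyTermD]
    fun_prop
  have hFc : ContinuousOn ellF (Set.Icc 0 x) := fun s hs =>
    (hasDerivAt_ellF (habs s hs)).continuousAt.continuousWithinAt
  have hGc : ContinuousOn ellG (Set.Icc 0 x) := fun s hs =>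
    (hasDerivAt_ellG (habs s hs)).continuousAt.continuousWithinAt
  have hR' : ∀ s ∈ Set.Ioo 0 x, HasDerivAt R (E s / (s * (1 - s))) s := fun s hs => by
    simp only [hE, Finset.sum_div]
    exact HasDerivAt.fun_sum fun n _ =>
      hasDerivAt_baileyTerm n y s hs.1.ne' (by linarith [hs.2])
  have hE' : ∀ s ∈ Set.Ioo 0 x, HasDerivAt E (R s / 4 -
      ((N : ℝ) + 1 / 2) ^ 2 * baileyTerm N y s) s := fun s hs =>
    hasDerivAt_sum_baileyTermD N y s hs.1.ne' (by linarith [hs.2])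
  have hF' : ∀ s ∈ Set.Ioo 0 x, HasDerivAt ellF (ellG s / (s * (1 - s))) s := fun s hs =>
    hasDerivAt_ellF_of_mem hs.1 (hs.2.trans hx1)
  have hW' : ∀ s ∈ Set.Ioo 0 x, HasDerivAt (fun s => E s * ellF s - R s * ellG s)
      (-(((N : ℝ) + 1 / 2) ^ 2 * baileyTerm N y s * ellF s)) s := fun s hs => by
    refine (((hE' s hs).mul (hF' s hs)).sub ((hR' s hs).mul
      (hasDerivAt_ellG (habs s ⟨hs.1.le, hs.2.le⟩)))).congr_deriv ?_
    ring
  have hE0 : E 0 = 0 := by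
    simp only [hE]
    refine Finset.sum_eq_zero fun n _ => ?_
    rw [baileyTermD, Finset.sum_eq_zero, mul_zero]
    intro j hj
    have hj : j ≤ n := Nat.lt_succ_iff.1 (Finset.mem_range.1 hj)
    rcases hj.eq_or_lt with rfl | hlt
    · simp
    · rw [zero_mul, zero_pow (by omega)]
      ring
  have hG0 : ellG 0 = 0 := by simp [ellG]
  have hW : ∀ s ∈ Set.Ioo 0 x, |E s * ellF s - R s * ellG s| ≤ K * s := fun s hs => by
    have hsub : Set.Icc 0 s ⊆ Set.Icc 0 x := Set.Icc_subset_Icc_right hs.2.le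
    obtain ⟨c, hc, hcs⟩ := exists_hasDerivAt_eq_slope _ _ hs.1
      ((hEc.continuousOn.mul (hFc.mono hsub)).sub (hRc.continuousOn.mul (hGc.mono hsub)))
      (fun r hr => hW' r ⟨hr.1, hr.2.trans hs.2⟩)
    have hcx : c ∈ Set.Icc 0 x := ⟨hc.1.le, (hc.2.trans hs.2).le⟩
    simp only [Pi.sub_apply, Pi.mul_apply] at hcs
    rw [hE0, hG0, zero_mul, mul_zero, sub_zero, sub_zero, sub_zero, eq_div_iff hs.1.ne'] at hcs
    have hb0 := baileyTerm_nonneg hcx.1 hy (by linarith [hcx.2]) N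
    rw [← hcs, abs_mul, abs_neg, abs_of_pos hs.1,
      abs_of_nonneg (by have := hF0 c hcx; positivity), hK]
    have := baileyTerm_le hcx.1 hy (by linarith [hcx.2]) (hq c hcx) N
    have hFm := ellF_mono hcx.1 hcx.2 hx1
    have := hF0 c hcx
    have hs0 := hs.1.le
    gcongr
  have hQ' : ∀ s ∈ Set.Ioo 0 x, HasDerivAt (fun s => R s / ellF s)
      ((E s * ellF s - R s * ellG s) / (s * (1 - s) * ellF s ^ 2)) s := fun s hs => by
    have h0 : ellF s ≠ 0 := by have := hF0 s ⟨hs.1.le, hs.2.le⟩; positivity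
    have h1 : 1 - s ≠ 0 := by linarith [hs.2]
    have h2 := hs.1.ne'
    refine ((hR' s hs).div (hF' s hs) h0).congr_deriv ?_
    field_simp
  obtain ⟨c, hc, hcs⟩ := exists_hasDerivAt_eq_slope _ _ hx
    (hRc.continuousOn.div hFc fun s hs => by have := hF0 s hs; positivity) hQ'
  have hR0 : R 0 / ellF 0 = ∑ n ∈ Finset.range (N + 1), sqCentral n * y ^ n := by
    simp [hR, ellF_zero, baileyTerm, sqBinomForm_zero_left]
  simp only [Pi.div_apply] at hcs
  rw [sub_zero, eq_div_iff hx.ne', hR0] at hcs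
  rw [← hcs, abs_mul, abs_of_pos hx]
  refine mul_le_mul_of_nonneg_right ?_ hx.le
  have hFc1 := hF0 c ⟨hc.1.le, hc.2.le⟩
  have hc1 : 0 < 1 - c := by linarith [hc.2]
  have hc0 := hc.1
  have hKnn : 0 ≤ K := by positivity
  rw [abs_div, abs_of_pos (by positivity : 0 < c * (1 - c) * ellF c ^ 2)]
  calc |E c * ellF c - R c * ellG c| / (c * (1 - c) * ellF c ^ 2)
      ≤ K * c / (c * (1 - x) * 1) := by
        have : 0 < 1 - x := by linarith
        gcongr
        · exact hW c hc
        · exact hc.2.le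
        · exact one_le_pow₀ hFc1
    _ = K / (1 - x) := by
        have : 1 - x ≠ 0 := by linarith
        field_simp

/-- Bailey's product formula for `₂F₁(1/2, 1/2; 1; ·)`. -/
theorem hasSum_baileyTerm {x y : ℝ} (hx : 0 < x) (hy : 0 ≤ y) (hxy : x + y < 1) :
    HasSum (fun n => baileyTerm n y x) (ellF x * ellF y) := by
  obtain ⟨m, hm, hmax⟩ := (isCompact_Icc (a := (0 : ℝ)) (b := x)).exists_isMaxOn
    ⟨0, le_rfl, hx.le⟩
    (f := fun s => (√(s * (1 - y)) + √(y * (1 - s))) ^ 2) (by fun_prop)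
  set q := (√(m * (1 - y)) + √(y * (1 - m))) ^ 2 with hqdef
  have hq0 : 0 ≤ q := by positivity
  have hq1 : q < 1 := sqrt_add_sqrt_sq_lt_one hm.1 hy (by linarith [hm.2])
  have hx1 : x < 1 := by linarith
  have hF : ellF x ≠ 0 := by have := one_le_ellF hx.le hx1; positivity
  rw [hasSum_iff_tendsto_nat_of_nonneg fun n => baileyTerm_nonneg hx.le hy hxy n,
    ← tendsto_add_atTop_iff_nat 1]
  have hpart : Tendsto (fun N => ∑ n ∈ Finset.range (N + 1), sqCentral n * y ^ n) atTop
      (nhds (ellF y)) :=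
    (tendsto_add_atTop_iff_nat 1).2
      (summable_ellF (by rw [abs_of_nonneg hy]; linarith)).hasSum.tendsto_sum_nat
  have hbound : Tendsto (fun N : ℕ => ((N : ℝ) + 1 / 2) ^ 2 * q ^ N * ellF x / (1 - x) * x)
      atTop (nhds 0) := by
    have h1 := (summable_succ_pow_mul_geometric 2 hq0 hq1).tendsto_atTop_zero
    have h2 : Tendsto (fun N : ℕ => ((N : ℝ) + 1 / 2) ^ 2 * q ^ N) atTop (nhds 0) := by
      refine squeeze_zero (fun N => by positivity) (fun N => ?_) h1
      gcongr
      norm_num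
    simpa using ((h2.mul_const (ellF x)).div_const (1 - x)).mul_const x
  have hle : ∀ s ∈ Set.Icc 0 x, (√(s * (1 - y)) + √(y * (1 - s))) ^ 2 ≤ q := fun s hs => hmax hs
  have hdiff := squeeze_zero_norm (f := fun N => (∑ n ∈ Finset.range (N + 1),
      baileyTerm n y x) / ellF x - ∑ n ∈ Finset.range (N + 1), sqCentral n * y ^ n)
    (fun N => abs_sum_baileyTerm_div_sub_le hx hy hxy hle N) hbound
  have hlim := (hdiff.add hpart).const_mul (ellF x)
  rw [zero_add] at hlim
  refine hlim.congr fun N => ?_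
  field_simp
  ring

lemma abs_baileyTerm_mul_pow_le {x y : ℝ} (hx : 0 ≤ x) (hy : 0 ≤ y) (hxy : x + y < 1) (i n : ℕ) :
    |baileyTerm n y x * (n : ℝ) ^ i| ≤
      1 * ((n : ℝ) + 1) ^ i * ((√(x * (1 - y)) + √(y * (1 - x))) ^ 2) ^ n := by
  have h := baileyTerm_le hx hy hxy le_rfl n
  have h0 := baileyTerm_nonneg hx hy hxy n
  rw [abs_of_nonneg (by positivity), one_mul, mul_comm]
  gcongr
  linarith

/-- The moments `∑ n^i r_n t^n` of the terms of Bailey's product formula. -/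
noncomputable def baileyMoment (i : ℕ) (x y t : ℝ) : ℝ :=
  ∑' n : ℕ, baileyTerm n y x * (n : ℝ) ^ i * t ^ n

lemma hasDerivAt_baileyMoment {x y t : ℝ} (hx : 0 < x) (hy : 0 ≤ y) (hxy : x + y < 1) (ht : 0 < t)
    (htq : t * (√(x * (1 - y)) + √(y * (1 - x))) ^ 2 < 1) (i : ℕ) :
    HasDerivAt (baileyMoment i x y) (baileyMoment (i + 1) x y t / t) t := by
  have hA : 0 < x * (1 - y) := mul_pos hx (by linarith)
  refine (hasDerivAt_tsum_mul_pow (abs_baileyTerm_mul_pow_le hx.le hy hxy i) (by positivity)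
    (by rwa [abs_of_pos ht])).congr_deriv ?_
  rw [baileyMoment, ← tsum_div_const]
  refine tsum_congr fun n => ?_
  rcases n with _ | n
  · simp
  · rw [Nat.add_sub_cancel]
    field_simp
    ring

lemma hasSum_baileyMoment {x y : ℝ} (hx : 0 ≤ x) (hy : 0 ≤ y) (hxy : x + y < 1) (i : ℕ) :
    HasSum (fun n => baileyTerm n y x * (n : ℝ) ^ i) (baileyMoment i x y 1) := by
  have h := (summable_mul_pow_of_abs_le (x := 1) (abs_baileyTerm_mul_pow_le hx hy hxy i)
    (by positivity) (by simpa using sqrt_add_sqrt_sq_lt_one hx hy hxy)).hasSum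
  simp only [one_pow, mul_one] at h
  convert h using 1
  simp [baileyMoment]

/-- The discriminant root `√(1 - 2 (A + B) t + (A - B)^2 t^2)` along the scaling flow through
`A = x (1 - y)`, `B = y (1 - x)`. -/
noncomputable def flowRoot (x y t : ℝ) : ℝ :=
  √(1 - 2 * (x * (1 - y) + y * (1 - x)) * t + (x - y) ^ 2 * t ^ 2)

/-- The coordinate `u` of the solution of `u (1 - v) = t x (1 - y)`, `v (1 - u) = t y (1 - x)`
through `(x, y)`; the other coordinate is `flow y x t`. -/
noncomputable def flow (x y t : ℝ) : ℝ := (1 - flowRoot x y t + (x - y) * t) / 2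

lemma flowRoot_comm (x y t : ℝ) : flowRoot x y t = flowRoot y x t := by
  rw [flowRoot, flowRoot]
  ring_nf

lemma flowRoot_one {x y : ℝ} (hxy : x + y < 1) : flowRoot x y 1 = 1 - x - y := by
  rw [flowRoot, ← Real.sqrt_sq (by linarith : 0 ≤ 1 - x - y)]
  ring_nf

lemma flow_one {x y : ℝ} (hxy : x + y < 1) : flow x y 1 = x := by
  rw [flow, flowRoot_one hxy]
  ring

lemma continuous_flowRoot (x y : ℝ) : Continuous (flowRoot x y) := by
  unfold flowRoot
  fun_prop

lemma continuous_flow (x y : ℝ) : Continuous (flow x y) := by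
  have := continuous_flowRoot x y
  unfold flow
  fun_prop

lemma flow_add_flow (x y t : ℝ) : flow x y t + flow y x t = 1 - flowRoot x y t := by
  rw [flow, flow, flowRoot_comm y x]
  ring

lemma flowRoot_sq {x y t : ℝ} (h : 0 < flowRoot x y t) :
    flowRoot x y t ^ 2 = 1 - 2 * (x * (1 - y) + y * (1 - x)) * t + (x - y) ^ 2 * t ^ 2 :=
  Real.sq_sqrt (Real.sqrt_pos.1 h).le

lemma flow_mul_one_sub_flow {x y t : ℝ} (h : 0 < flowRoot x y t) :
    flow x y t * (1 - flow y x t) = t * (x * (1 - y)) := by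
  have := flowRoot_sq h
  rw [flow, flow, flowRoot_comm y x]
  linear_combination (-1 / 4) * this

lemma hasDerivAt_flowRoot {x y t : ℝ} (ht : t ≠ 0) (h : 0 < flowRoot x y t) :
    HasDerivAt (flowRoot x y) (-((flow x y t * (1 - flow x y t) +
      flow y x t * (1 - flow y x t)) / flowRoot x y t / t)) t := by
  have h1 : HasDerivAt (fun t : ℝ => 1 - 2 * (x * (1 - y) + y * (1 - x)) * t + (x - y) ^ 2 * t ^ 2)
      (-(2 * (x * (1 - y) + y * (1 - x))) + (x - y) ^ 2 * (2 * t)) t := by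
    have := (((hasDerivAt_id t).const_mul (2 * (x * (1 - y) + y * (1 - x)))).const_sub 1).add
      ((hasDerivAt_pow 2 t).const_mul ((x - y) ^ 2))
    refine this.congr_deriv ?_
    push_cast
    ring
  refine (h1.sqrt (Real.sqrt_pos.1 h).ne').congr_deriv ?_
  have hsq := flowRoot_sq h
  rw [← flowRoot, flow, flow, flowRoot_comm y x]
  have h0 := h.ne'
  field_simp
  linear_combination (-2) * hsq

lemma hasDerivAt_flow {x y t : ℝ} (ht : t ≠ 0) (h : 0 < flowRoot x y t) :
    HasDerivAt (flow x y) (flow x y t * (1 - flow x y t) / flowRoot x y t / t) t := by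
  have h1 := (((hasDerivAt_flowRoot ht h).const_sub 1).add
    ((hasDerivAt_id t).const_mul (x - y))).div_const 2
  refine h1.congr_deriv ?_
  have hsq := flowRoot_sq h
  rw [flow, flow, flowRoot_comm y x]
  have h0 := h.ne'
  field_simp
  ring

/-- The conditions on `t` under which the scaling flow through `(x, y)` stays in the region of
convergence. -/
def FlowAdmissible (x y t : ℝ) : Prop :=
  0 < t ∧ t * (√(x * (1 - y)) + √(y * (1 - x))) ^ 2 < 1 ∧ 0 < flowRoot x y t ∧
    0 < flow x y t ∧ 0 < flow y x t

lemma flowAdmissible_one {x y : ℝ} (hx : 0 < x) (hy : 0 < y) (hxy : x + y < 1) :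
    FlowAdmissible x y 1 := by
  refine ⟨one_pos, by simpa using sqrt_add_sqrt_sq_lt_one hx.le hy.le hxy, ?_, ?_, ?_⟩
  · rw [flowRoot_one hxy]; linarith
  · rwa [flow_one hxy]
  · rwa [flow_one (by linarith)]

lemma FlowAdmissible.eventually {x y t : ℝ} (h : FlowAdmissible x y t) :
    ∀ᶠ s in nhds t, FlowAdmissible x y s := by
  have h2 : ∀ᶠ s : ℝ in nhds t, s * (√(x * (1 - y)) + √(y * (1 - x))) ^ 2 < 1 :=
    ContinuousAt.eventually_lt (by fun_prop) continuousAt_const h.2.1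
  filter_upwards [lt_mem_nhds h.1, h2,
    continuousAt_const.eventually_lt (continuous_flowRoot x y).continuousAt h.2.2.1,
    continuousAt_const.eventually_lt (continuous_flow x y).continuousAt h.2.2.2.1,
    continuousAt_const.eventually_lt (continuous_flow y x).continuousAt h.2.2.2.2]
    with s a b c d e using ⟨a, b, c, d, e⟩

lemma baileyMoment_zero_eq {x y t : ℝ} (h : FlowAdmissible x y t) :
    baileyMoment 0 x y t = ellF (flow x y t) * ellF (flow y x t) := by
  obtain ⟨ht, -, hr, hu, hv⟩ := h
  have hr' : 0 < flowRoot y x t := by rwa [flowRoot_comm]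
  rw [← (hasSum_baileyTerm hu hv.le (by linarith [flow_add_flow x y t])).tsum_eq, baileyMoment]
  refine tsum_congr fun n => ?_
  rw [baileyTerm, baileyTerm, flow_mul_one_sub_flow hr, flow_mul_one_sub_flow hr',
    sqBinomForm_mul]
  ring

lemma baileyMoment_succ_eq {x y : ℝ} (hx : 0 < x) (hy : 0 < y) (hxy : x + y < 1) {i : ℕ}
    {f g : ℝ → ℝ} (hf : ∀ t, FlowAdmissible x y t → baileyMoment i x y t = f t)
    (hg : ∀ t, FlowAdmissible x y t → HasDerivAt f (g t / t) t) {t : ℝ}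
    (ht : FlowAdmissible x y t) :
    baileyMoment (i + 1) x y t = g t := by
  have h1 := hasDerivAt_baileyMoment hx hy.le hxy ht.1 ht.2.1 i
  have h2 := (hg t ht).congr_of_eventuallyEq (ht.eventually.mono hf)
  have h3 := h1.unique h2
  have h4 := ht.1.ne'
  field_simp at h3
  exact h3

/-- The first four moments at `t = 1` in terms of `ellF` and `ellG`. -/
lemma baileyMoment_one_eq {x y : ℝ} (hx : 0 < x) (hy : 0 < y) (hxy : x + y < 1) :
    let f := ellF x
    let g := ellF y
    let φ := ellG x
    let γ := ellG y
    let ρ := 1 - x - y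
    let a := x * (1 - x)
    let b := y * (1 - y)
    let P := φ * g + f * γ
    let Q := (a + b) / 4 * (f * g) + 2 * (φ * γ)
    let e := (1 - 2 * x) * a + (1 - 2 * y) * b
    baileyMoment 0 x y 1 = f * g ∧
    baileyMoment 1 x y 1 = P / ρ ∧
    baileyMoment 2 x y 1 = Q / ρ ^ 2 + P * (a + b) / ρ ^ 3 ∧
    baileyMoment 3 x y 1 =
      (e / 4 * (f * g) + (a + b) / 4 * P + (a * (f * γ) + b * (φ * g)) / 2) / ρ ^ 3 +
      (3 * Q * (a + b) + P * e) / ρ ^ 4 + 3 * P * (a + b) ^ 2 / ρ ^ 5 := by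
  set r := flowRoot x y with hr
  set u := flow x y with hu
  set v := flow y x with hv
  set a : ℝ → ℝ := fun t => u t * (1 - u t) with ha
  set b : ℝ → ℝ := fun t => v t * (1 - v t) with hb
  set f : ℝ → ℝ := fun t => ellF (u t) with hf
  set g : ℝ → ℝ := fun t => ellF (v t) with hg
  set φ : ℝ → ℝ := fun t => ellG (u t) with hφ
  set γ : ℝ → ℝ := fun t => ellG (v t) with hγ
  have hpos : ∀ t, FlowAdmissible x y t → t ≠ 0 ∧ r t ≠ 0 :=
    fun t ht => ⟨ht.1.ne', ht.2.2.1.ne'⟩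
  have hlt : ∀ t, FlowAdmissible x y t → u t < 1 ∧ v t < 1 := fun t ht => by
    have := flow_add_flow x y t
    obtain ⟨-, -, h1, h2, h3⟩ := ht
    exact ⟨by linarith, by linarith⟩
  have dr : ∀ t, FlowAdmissible x y t → HasDerivAt r (-((a t + b t) / r t / t)) t :=
    fun t ht => hasDerivAt_flowRoot ht.1.ne' ht.2.2.1
  have du : ∀ t, FlowAdmissible x y t → HasDerivAt u (a t / r t / t) t :=
    fun t ht => hasDerivAt_flow ht.1.ne' ht.2.2.1
  have dv : ∀ t, FlowAdmissible x y t → HasDerivAt v (b t / r t / t) t := fun t ht => by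
    rw [hr, flowRoot_comm]
    exact hasDerivAt_flow ht.1.ne' (by rw [flowRoot_comm]; exact ht.2.2.1)
  have df : ∀ t, FlowAdmissible x y t → HasDerivAt f (φ t / r t / t) t := fun t ht => by
    have h1 := ht.2.2.2.1
    have h2 := (hlt t ht).1
    refine ((hasDerivAt_ellF_of_mem h1 h2).comp t (du t ht)).congr_deriv ?_
    have : a t ≠ 0 := (mul_pos h1 (by linarith)).ne'
    obtain ⟨h3, h4⟩ := hpos t ht
    change ellG (u t) / a t * (a t / r t / t) = ellG (u t) / r t / t
    field_simp
  have dg : ∀ t, FlowAdmissible x y t → HasDerivAt g (γ t / r t / t) t := fun t ht => by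
    have h1 := ht.2.2.2.2
    have h2 := (hlt t ht).2
    refine ((hasDerivAt_ellF_of_mem h1 h2).comp t (dv t ht)).congr_deriv ?_
    have : b t ≠ 0 := (mul_pos h1 (by linarith)).ne'
    obtain ⟨h3, h4⟩ := hpos t ht
    change ellG (v t) / b t * (b t / r t / t) = ellG (v t) / r t / t
    field_simp
  have dφ : ∀ t, FlowAdmissible x y t → HasDerivAt φ (f t / 4 * (a t / r t / t)) t := fun t ht =>
    (hasDerivAt_ellG (abs_lt.2 ⟨by linarith [ht.2.2.2.1], (hlt t ht).1⟩)).comp t (du t ht)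
  have dγ : ∀ t, FlowAdmissible x y t → HasDerivAt γ (g t / 4 * (b t / r t / t)) t := fun t ht =>
    (hasDerivAt_ellG (abs_lt.2 ⟨by linarith [ht.2.2.2.2], (hlt t ht).2⟩)).comp t (dv t ht)
  have da : ∀ t, FlowAdmissible x y t → HasDerivAt a ((1 - 2 * u t) * a t / r t / t) t :=
    fun t ht => ((du t ht).mul ((du t ht).const_sub 1)).congr_deriv (by ring)
  have db : ∀ t, FlowAdmissible x y t → HasDerivAt b ((1 - 2 * v t) * b t / r t / t) t :=
    fun t ht => ((dv t ht).mul ((dv t ht).const_sub 1)).congr_deriv (by ring)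
  set P : ℝ → ℝ := fun t => φ t * g t + f t * γ t with hP
  set Q : ℝ → ℝ := fun t => (a t + b t) / 4 * (f t * g t) + 2 * (φ t * γ t) with hQ
  set e : ℝ → ℝ := fun t => (1 - 2 * u t) * a t + (1 - 2 * v t) * b t with he
  set Q' : ℝ → ℝ := fun t => e t / 4 * (f t * g t) + (a t + b t) / 4 * P t +
    (a t * (f t * γ t) + b t * (φ t * g t)) / 2 with hQ'
  have dP : ∀ t, FlowAdmissible x y t → HasDerivAt P (Q t / r t / t) t := fun t ht =>
    (((dφ t ht).mul (dg t ht)).add ((df t ht).mul (dγ t ht))).congr_deriv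
      (by simp only [hQ]; ring)
  have dQ : ∀ t, FlowAdmissible x y t → HasDerivAt Q (Q' t / r t / t) t := fun t ht =>
    (((((da t ht).add (db t ht)).div_const 4).mul ((df t ht).mul (dg t ht))).add
      (((dφ t ht).mul (dγ t ht)).const_mul 2)).congr_deriv
      (by simp only [hQ', hP, he, Pi.mul_apply, Pi.add_apply]; ring)
  have m0 : ∀ t, FlowAdmissible x y t → baileyMoment 0 x y t = f t * g t :=
    fun t ht => baileyMoment_zero_eq ht
  have m1 : ∀ t, FlowAdmissible x y t → baileyMoment 1 x y t = P t / r t := fun t ht =>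
    baileyMoment_succ_eq (g := fun t => P t / r t) hx hy hxy m0
      (fun t ht => ((df t ht).mul (dg t ht)).congr_deriv (by simp only [hP]; ring)) ht
  have m2 : ∀ t, FlowAdmissible x y t → baileyMoment 2 x y t =
      Q t / r t ^ 2 + P t * (a t + b t) / r t ^ 3 := fun t ht =>
    baileyMoment_succ_eq (g := fun t => Q t / r t ^ 2 + P t * (a t + b t) / r t ^ 3)
      hx hy hxy m1 (fun t ht => by
        obtain ⟨h1, h2⟩ := hpos t ht
        refine ((dP t ht).div (dr t ht) h2).congr_deriv ?_
        field_simp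
        ring) ht
  have m3 : ∀ t, FlowAdmissible x y t → baileyMoment 3 x y t =
      Q' t / r t ^ 3 + (3 * Q t * (a t + b t) + P t * e t) / r t ^ 4 +
        3 * P t * (a t + b t) ^ 2 / r t ^ 5 := fun t ht =>
    baileyMoment_succ_eq (g := fun t => Q' t / r t ^ 3 +
      (3 * Q t * (a t + b t) + P t * e t) / r t ^ 4 + 3 * P t * (a t + b t) ^ 2 / r t ^ 5)
      hx hy hxy m2 (fun t ht => by
        obtain ⟨h1, h2⟩ := hpos t ht
        refine (((dQ t ht).div ((dr t ht).pow 2) (pow_ne_zero 2 h2)).add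
          (((dP t ht).mul ((da t ht).add (db t ht))).div ((dr t ht).pow 3)
            (pow_ne_zero 3 h2))).congr_deriv ?_
        simp only [Pi.pow_apply, Pi.add_apply, Pi.mul_apply, he]
        push_cast
        field_simp
        ring) ht
  have h1 := flowAdmissible_one hx hy hxy
  have hu1 : u 1 = x := flow_one hxy
  have hv1 : v 1 = y := flow_one (by linarith)
  have hr1 : r 1 = 1 - x - y := flowRoot_one hxy
  have e0 := m0 1 h1
  have e1 := m1 1 h1
  have e2 := m2 1 h1
  have e3 := m3 1 h1
  simp only [hQ', hP, hQ, he, hf, hg, hφ, hγ, ha, hb, hu1, hv1, hr1] at e0 e1 e2 e3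
  exact ⟨e0, e1, e2, e3⟩

/-- The combination of `ellF` and `ellG` at `((1 - k) / (1 + k))^2` and `k^2` that is constant by
Legendre's relation. -/
noncomputable def legendreComb (k : ℝ) : ℝ :=
  (1 + k) * (ellF (k ^ 2) * ellG (((1 - k) / (1 + k)) ^ 2)) +
    k * (1 - k) / (1 + k) * (ellF (((1 - k) / (1 + k)) ^ 2) * ellF (k ^ 2)) +
    2 / (1 + k) * (ellG (k ^ 2) * ellF (((1 - k) / (1 + k)) ^ 2))

lemma landen_sq_mem {k : ℝ} (hk0 : 0 < k) (hk1 : k < 1) :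
    0 < ((1 - k) / (1 + k)) ^ 2 ∧ ((1 - k) / (1 + k)) ^ 2 < 1 := by
  have h : 0 < (1 - k) / (1 + k) := div_pos (by linarith) (by linarith)
  refine ⟨by positivity, pow_lt_one₀ h.le ?_ two_ne_zero⟩
  rw [div_lt_one (by linarith)]
  linarith

lemma hasDerivAt_legendreComb {k : ℝ} (hk0 : 0 < k) (hk1 : k < 1) :
    HasDerivAt legendreComb 0 k := by
  obtain ⟨hx0, hx1⟩ := landen_sq_mem hk0 hk1
  have hy0 : 0 < k ^ 2 := by positivity
  have hy1 : k ^ 2 < 1 := pow_lt_one₀ hk0.le hk1 two_ne_zero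
  have hk : k ≠ 0 := hk0.ne'
  have h1 : 1 + k ≠ 0 := by linarith
  have h2 : 1 - k ≠ 0 := by linarith
  have dsq : HasDerivAt (fun k : ℝ => k ^ 2) (2 * k) k := by simpa using hasDerivAt_pow 2 k
  have d1 : HasDerivAt (fun k : ℝ => 1 + k) 1 k := (hasDerivAt_id k).const_add 1
  have d2 : HasDerivAt (fun k : ℝ => 1 - k) (-1) k := (hasDerivAt_id k).const_sub 1
  have dx : HasDerivAt (fun k : ℝ => ((1 - k) / (1 + k)) ^ 2)
      (-4 * (1 - k) / (1 + k) ^ 3) k := by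
    refine ((d2.div d1 h1).pow 2).congr_deriv ?_
    simp only [Pi.div_apply, Nat.add_one_sub_one, pow_one]
    field_simp
    ring
  have df : HasDerivAt (fun k : ℝ => ellF (((1 - k) / (1 + k)) ^ 2))
      (-(ellG (((1 - k) / (1 + k)) ^ 2) * (1 + k) / (k * (1 - k)))) k := by
    refine ((hasDerivAt_ellF_of_mem hx0 hx1).comp k dx).congr_deriv ?_
    have : 1 - ((1 - k) / (1 + k)) ^ 2 = 4 * k / (1 + k) ^ 2 := by
      field_simp
      ring
    rw [this]
    field_simp
  have dφ : HasDerivAt (fun k : ℝ => ellG (((1 - k) / (1 + k)) ^ 2))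
      (ellF (((1 - k) / (1 + k)) ^ 2) / 4 * (-4 * (1 - k) / (1 + k) ^ 3)) k :=
    (hasDerivAt_ellG (by rwa [abs_of_pos hx0])).comp k dx
  have dg : HasDerivAt (fun k : ℝ => ellF (k ^ 2))
      (2 * ellG (k ^ 2) / (k * ((1 - k) * (1 + k)))) k := by
    refine (HasDerivAt.comp (h₂ := ellF) (h := fun k : ℝ => k ^ 2) k
      (hasDerivAt_ellF_of_mem hy0 hy1) dsq).congr_deriv ?_
    have : 1 - k ^ 2 = (1 - k) * (1 + k) := by ring
    rw [this]
    field_simp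
  have dγ : HasDerivAt (fun k : ℝ => ellG (k ^ 2)) (ellF (k ^ 2) / 4 * (2 * k)) k :=
    HasDerivAt.comp (h₂ := ellG) (h := fun k : ℝ => k ^ 2) k
      (hasDerivAt_ellG (by rwa [abs_of_pos hy0])) dsq
  have hall := ((d1.mul (dg.mul dφ)).add
    (((((hasDerivAt_id k).mul d2).div d1 h1)).mul (df.mul dg))).add
    (((hasDerivAt_const k (2 : ℝ)).div d1 h1).mul (dγ.mul df))
  refine hall.congr_deriv ?_
  simp only [Pi.mul_apply, Pi.div_apply, id]
  field_simp
  ring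

lemma tendsto_legendreComb :
    Tendsto legendreComb (nhdsWithin 0 (Set.Ioi 0)) (nhds (1 / π)) := by
  have hmem : ∀ᶠ k : ℝ in nhdsWithin 0 (Set.Ioi 0), 0 < k ∧ k < 1 := by
    filter_upwards [self_mem_nhdsWithin, nhdsWithin_le_nhds (gt_mem_nhds one_pos)] with k h1 h2
      using ⟨h1, h2⟩
  have hx : Tendsto (fun k : ℝ => ((1 - k) / (1 + k)) ^ 2) (nhdsWithin 0 (Set.Ioi 0))
      (nhdsWithin 1 (Set.Iio 1)) := by
    refine tendsto_nhdsWithin_iff.2 ⟨tendsto_nhdsWithin_of_tendsto_nhds ?_, ?_⟩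
    · have : ContinuousAt (fun k : ℝ => ((1 - k) / (1 + k)) ^ 2) 0 := by
        refine ContinuousAt.pow (ContinuousAt.div (by fun_prop) (by fun_prop) (by norm_num)) 2
      simpa [ContinuousAt] using this
    · filter_upwards [hmem] with k hk using (landen_sq_mem hk.1 hk.2).2
  have hφ := tendsto_ellG.comp hx
  have hf := tendsto_one_sub_mul_ellF.comp hx
  have hc : ∀ {F : ℝ → ℝ} {l : ℝ}, ContinuousAt F 0 → F 0 = l →
      Tendsto F (nhdsWithin 0 (Set.Ioi 0)) (nhds l) := fun h h' =>
    h' ▸ h.tendsto.mono_left nhdsWithin_le_nhds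
  have h0 : |(0 : ℝ)| < 1 := by simp
  have hg : Tendsto (fun k : ℝ => ellF (k ^ 2)) (nhdsWithin 0 (Set.Ioi 0)) (nhds 1) := by
    refine hc (ContinuousAt.comp (g := ellF) (f := fun k : ℝ => k ^ 2) ?_ (by fun_prop)) ?_
    · simpa using (hasDerivAt_ellF h0).continuousAt
    · simp [ellF_zero]
  have hF' : Tendsto (fun k : ℝ => k * (1 - k ^ 2) * ellF' (k ^ 2)) (nhdsWithin 0 (Set.Ioi 0))
      (nhds 0) := by
    have hF : ContinuousAt ellF' 0 :=
      (hasDerivAt_tsum_mul_pow abs_succ_mul_sqCentral_le one_pos (by simp)).continuousAt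
    refine hc (ContinuousAt.mul (by fun_prop)
      (ContinuousAt.comp (g := ellF') (f := fun k : ℝ => k ^ 2) ?_ (by fun_prop))) (by simp)
    simpa using hF
  have hone : Tendsto (fun k : ℝ => 1 + k) (nhdsWithin 0 (Set.Ioi 0)) (nhds 1) :=
    hc (by fun_prop) (by simp)
  have hcoef : Tendsto (fun k : ℝ => (1 - k) * (1 + k) / 4) (nhdsWithin 0 (Set.Ioi 0))
      (nhds (1 / 4)) := hc (by fun_prop) (by simp)
  have hcoef2 : Tendsto (fun k : ℝ => (1 + k) / 2) (nhdsWithin 0 (Set.Ioi 0))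
      (nhds (1 / 2)) := hc (by fun_prop) (by simp)
  have hall := ((hone.mul (hg.mul hφ)).add (hcoef.mul (hf.mul hg))).add
    (hcoef2.mul (hF'.mul hf))
  have hl : 1 * (1 * (1 / π)) + 1 / 4 * (0 * 1) + 1 / 2 * (0 * 0) = 1 / π := by ring
  rw [hl] at hall
  refine hall.congr' ?_
  filter_upwards [hmem] with k hk
  have h1 : 1 + k ≠ 0 := by linarith [hk.1]
  have hxk : 1 - ((1 - k) / (1 + k)) ^ 2 = 4 * k / (1 + k) ^ 2 := by
    field_simp
    ring
  simp only [Function.comp, legendreComb, hxk, ellG]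
  field_simp
  ring

/-- Legendre's relation, in terms of `ellF` and a Landen-transformed complementary modulus. -/
theorem legendreComb_eq {k : ℝ} (hk0 : 0 < k) (hk1 : k < 1) : legendreComb k = 1 / π := by
  have hconst : ∀ s ∈ Set.Ioo (0 : ℝ) 1, legendreComb s = legendreComb k := fun s hs =>
    isOpen_Ioo.is_const_of_deriv_eq_zero isPreconnected_Ioo
      (fun r hr => (hasDerivAt_legendreComb hr.1 hr.2).differentiableAt.differentiableWithinAt)
      (fun r hr => (hasDerivAt_legendreComb hr.1 hr.2).deriv) hs ⟨hk0, hk1⟩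
  refine tendsto_nhds_unique (tendsto_const_nhds.congr' ?_) tendsto_legendreComb
  filter_upwards [Ioo_mem_nhdsGT (one_pos : (0 : ℝ) < 1)] with s hs using (hconst s hs).symm

lemma legendreP_mul_pow (n : ℕ) {w z A B : ℝ} (hA : (w - 1) * z = 2 * A)
    (hB : (w + 1) * z = 2 * B) : legendreP n w * z ^ n = sqBinomForm n A B := by
  rw [legendreP, sqBinomForm, Finset.mul_sum, Finset.sum_mul]
  refine Finset.sum_congr rfl fun j hj => ?_
  have hj : j ≤ n := Nat.lt_succ_iff.1 (Finset.mem_range.1 hj)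
  have hA' : A = 2⁻¹ * ((w - 1) * z) := by rw [hA]; ring
  have hB' : B = 2⁻¹ * ((w + 1) * z) := by rw [hB]; ring
  obtain ⟨i, rfl⟩ := Nat.exists_eq_add_of_le hj
  rw [Nat.add_sub_cancel_left, hA', hB']
  simp only [mul_pow, pow_add]
  ring

theorem stmt0 (k : ℝ) (hk0 : 0 < k) (hk1 : k < 1) (hk : k ≠ Real.sqrt 2 - 1) :
    Tendsto (fun N => ∑ n ∈ Finset.range N,
      ((2 * n).choose n : ℝ) ^ 2 *
        legendreP n ((-k ^ 4 + 6 * k ^ 3 - 2 * k + 1) / ((k ^ 2 + 1) * (k ^ 2 + 2 * k - 1))) *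
        ((k ^ 2 + 1) * (k ^ 2 + 2 * k - 1) / (16 * (k + 1) ^ 2)) ^ n *
        (4 * (k - 1) ^ 2 * k ^ 2 * (k ^ 2 + 3 * k + 4) ^ 2 * (n : ℝ) ^ 3 +
         12 * (k - 1) * k * (k ^ 6 + 5 * k ^ 5 + 10 * k ^ 4 + 10 * k ^ 3 + 5 * k ^ 2 - 3 * k + 4) * (n : ℝ) ^ 2 +
         (9 * k ^ 8 + 36 * k ^ 7 + 37 * k ^ 6 + 8 * k ^ 5 - 9 * k ^ 4 - 56 * k ^ 3 + 63 * k ^ 2 - 28 * k + 4) * (n : ℝ) +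
         (k ^ 2 + 2 * k - 1) ^ 2 * (2 * k ^ 4 + 3 * k ^ 2 - 2 * k + 1)))
      atTop (nhds (2 * (k + 1) ^ 3 * (k ^ 2 + 1) / π)) := by
  have hx0 := (landen_sq_mem hk0 hk1).1
  have hy0 : 0 < k ^ 2 := by positivity
  have h1 : 1 + k ≠ 0 := by linarith
  have h1' : k + 1 ≠ 0 := by linarith
  have h2 : 1 - k ≠ 0 := by linarith
  have hk' : k ≠ 0 := hk0.ne'
  have h3 : k ^ 2 + 3 * k + 4 ≠ 0 := by positivity
  have h4 : k ^ 2 + 1 ≠ 0 := by positivity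
  have h5 : k ^ 2 + 2 * k - 1 ≠ 0 := by
    intro h
    apply hk
    have h6 : (k + 1) ^ 2 = 2 := by linarith
    rw [← h6, Real.sqrt_sq (by linarith)]
    ring
  have hρ : 1 - ((1 - k) / (1 + k)) ^ 2 - k ^ 2 =
      (1 - k) * k * (k ^ 2 + 3 * k + 4) / (1 + k) ^ 2 := by
    field_simp
    ring
  have hxy : ((1 - k) / (1 + k)) ^ 2 + k ^ 2 < 1 := by
    have : 0 < 1 - k := by linarith
    have : 0 < (1 - k) * k * (k ^ 2 + 3 * k + 4) / (1 + k) ^ 2 := by positivity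
    linarith
  have hmom := hasSum_baileyMoment hx0.le hy0.le hxy
  have hsum := ((((hmom 3).mul_left (4 * (k - 1) ^ 2 * k ^ 2 * (k ^ 2 + 3 * k + 4) ^ 2)).add
    ((hmom 2).mul_left (12 * (k - 1) * k *
      (k ^ 6 + 5 * k ^ 5 + 10 * k ^ 4 + 10 * k ^ 3 + 5 * k ^ 2 - 3 * k + 4)))).add
    ((hmom 1).mul_left (9 * k ^ 8 + 36 * k ^ 7 + 37 * k ^ 6 + 8 * k ^ 5 - 9 * k ^ 4 -
      56 * k ^ 3 + 63 * k ^ 2 - 28 * k + 4))).add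
    ((hmom 0).mul_left ((k ^ 2 + 2 * k - 1) ^ 2 * (2 * k ^ 4 + 3 * k ^ 2 - 2 * k + 1)))
  have hterm : ∀ n : ℕ, ((2 * n).choose n : ℝ) ^ 2 *
      legendreP n ((-k ^ 4 + 6 * k ^ 3 - 2 * k + 1) / ((k ^ 2 + 1) * (k ^ 2 + 2 * k - 1))) *
      ((k ^ 2 + 1) * (k ^ 2 + 2 * k - 1) / (16 * (k + 1) ^ 2)) ^ n =
      baileyTerm n (k ^ 2) (((1 - k) / (1 + k)) ^ 2) := fun n => by
    have hwz : (-k ^ 4 + 6 * k ^ 3 - 2 * k + 1) / ((k ^ 2 + 1) * (k ^ 2 + 2 * k - 1)) *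
        ((k ^ 2 + 1) * (k ^ 2 + 2 * k - 1) / (k + 1) ^ 2) =
        (-k ^ 4 + 6 * k ^ 3 - 2 * k + 1) / (k + 1) ^ 2 :=
      div_mul_div_cancel₀ (mul_ne_zero h4 h5)
    have h4n : ((1 / 4 : ℝ) ^ 2) ^ n = 1 / (4 ^ n) ^ 2 := by
      rw [← pow_mul, mul_comm 2 n, pow_mul, one_div_pow, one_div_pow]
    rw [baileyTerm, ← legendreP_mul_pow n
      (w := (-k ^ 4 + 6 * k ^ 3 - 2 * k + 1) / ((k ^ 2 + 1) * (k ^ 2 + 2 * k - 1)))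
      (z := (k ^ 2 + 1) * (k ^ 2 + 2 * k - 1) / (k + 1) ^ 2)
      (by rw [sub_mul, hwz]; field_simp; ring) (by rw [add_mul, hwz]; field_simp; ring),
      sqCentral, Nat.centralBinom]
    have h16 : (k ^ 2 + 1) * (k ^ 2 + 2 * k - 1) / (16 * (k + 1) ^ 2) =
        (1 / 4) ^ 2 * ((k ^ 2 + 1) * (k ^ 2 + 2 * k - 1) / (k + 1) ^ 2) := by
      field_simp
      norm_num
    rw [h16, mul_pow, h4n]
    ring
  have hval : 2 * (k + 1) ^ 3 * (k ^ 2 + 1) / π =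
      2 * (k + 1) ^ 3 * (k ^ 2 + 1) * legendreComb k := by
    rw [legendreComb_eq hk0 hk1]
    ring
  refine (hsum.tendsto_sum_nat.congr fun N => ?_).trans_eq ?_
  · refine Finset.sum_congr rfl fun n _ => ?_
    rw [hterm]
    ring
  · congr 1
    obtain ⟨e0, e1, e2, e3⟩ := baileyMoment_one_eq hx0 hy0 hxy
    rw [hρ] at e1 e2 e3
    rw [hval, e0, e1, e2, e3, legendreComb]
    generalize ellF (((1 - k) / (1 + k)) ^ 2) = f
    generalize ellG (((1 - k) / (1 + k)) ^ 2) = φ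
    generalize ellF (k ^ 2) = g
    generalize ellG (k ^ 2) = γ
    field_simp
    ring
end

section
/- The series ∑_{n=0}^∞ C(2n,n)² · P_n(11/5) · (5/576)^n · (14 − 171n − 4452n² + 2116n³) converges to 2160/π. -/
open Real Filter

/-- The coefficient `(C(2n,n) / 4^n)^2` of the power series `2 K(k) / π` in `k^2`. -/
noncomputable def ellCoeff (n : ℕ) : ℝ := ((n.centralBinom : ℝ) / 4 ^ n) ^ 2

lemma ellCoeff_zero : ellCoeff 0 = 1 := by simp [ellCoeff]

lemma ellCoeff_nonneg (n : ℕ) : 0 ≤ ellCoeff n := sq_nonneg _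

lemma ellCoeff_succ (n : ℕ) :
    ((n : ℝ) + 1) ^ 2 * ellCoeff (n + 1) = ((n : ℝ) + 1 / 2) ^ 2 * ellCoeff n := by
  have h : ((n : ℝ) + 1) * (n + 1).centralBinom = 2 * (2 * n + 1) * n.centralBinom := by
    exact_mod_cast Nat.succ_mul_centralBinom_succ n
  calc ((n : ℝ) + 1) ^ 2 * ellCoeff (n + 1)
      = (((n : ℝ) + 1) * (n + 1).centralBinom) ^ 2 / (4 ^ (n + 1)) ^ 2 := by
        rw [ellCoeff]; ring
    _ = ((n : ℝ) + 1 / 2) ^ 2 * ellCoeff n := by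
        rw [h, ellCoeff, pow_succ]; field_simp; ring

lemma ellCoeff_le_one (n : ℕ) : ellCoeff n ≤ 1 := by
  induction n with
  | zero => rw [ellCoeff_zero]
  | succ n ih =>
    have h := ellCoeff_succ n
    have h0 := ellCoeff_nonneg n
    have hn : (0 : ℝ) ≤ n := n.cast_nonneg
    by_contra! hc
    nlinarith [mul_le_mul_of_nonneg_left ih (sq_nonneg ((n : ℝ) + 1 / 2))]

lemma ellCoeff_mul_W (n : ℕ) : ellCoeff n * (2 * n + 1) * Wallis.W n = 1 := by
  induction n with
  | zero => simp [ellCoeff_zero, Wallis.W]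
  | succ n ih =>
    have h := ellCoeff_succ n
    have h2 : ellCoeff (n + 1) = ((n : ℝ) + 1 / 2) ^ 2 * ellCoeff n / ((n : ℝ) + 1) ^ 2 := by
      rw [← h]; field_simp
    refine Eq.trans ?_ ih
    rw [Wallis.W_succ, h2]
    push_cast
    field_simp
    ring

lemma tendsto_mul_ellCoeff :
    Tendsto (fun n : ℕ => (n : ℝ) * ellCoeff n) atTop (nhds (1 / π)) := by
  have h1 : Tendsto (fun n : ℕ => (n : ℝ) / (n + 1 / 2)) atTop (nhds 1) :=
    tendsto_natCast_div_add_atTop _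
  have h2 := (h1.const_mul (1 / 2)).div Wallis.tendsto_W_nhds_pi_div_two (by positivity)
  have e : (1 / 2 * 1 / (π / 2) : ℝ) = 1 / π := by field_simp
  rw [e] at h2
  refine h2.congr fun n => ?_
  have hW := Wallis.W_pos n
  have h3 := ellCoeff_mul_W n
  simp only [Pi.div_apply]
  rw [div_eq_iff hW.ne']
  field_simp
  linear_combination (-(n : ℝ)) * h3

lemma tendsto_ellCoeff : Tendsto ellCoeff atTop (nhds 0) := by
  have h := tendsto_mul_ellCoeff.mul tendsto_inv_atTop_nhds_zero_nat
  rw [mul_zero] at h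
  refine h.congr' ?_
  filter_upwards [eventually_ne_atTop 0] with n hn
  have : (n : ℝ) ≠ 0 := by exact_mod_cast hn
  field_simp

lemma summable_powerSeries_of_abs_le {c : ℕ → ℝ} (hc : ∀ n, |c n| ≤ n + 1) {x : ℝ}
    (hx : |x| < 1) : Summable fun n => c n * x ^ n := by
  have h1 := summable_pow_mul_geometric_of_norm_lt_one 1 (r := |x|) (by simpa using hx)
  have h0 := summable_geometric_of_lt_one (abs_nonneg x) hx
  refine Summable.of_norm_bounded (h1.add h0) fun n => ?_
  rw [norm_mul, norm_pow, Real.norm_eq_abs, Real.norm_eq_abs]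
  have := mul_le_mul_of_nonneg_right (hc n) (pow_nonneg (abs_nonneg x) n)
  linarith

lemma hasDerivAt_powerSeries_of_abs_le {c : ℕ → ℝ} (hc : ∀ n, |c n| ≤ n + 1) {x : ℝ}
    (hx : |x| < 1) :
    HasDerivAt (fun y => ∑' n, c n * y ^ n)
      (∑' n : ℕ, ((n : ℝ) + 1) * c (n + 1) * x ^ n) x := by
  obtain ⟨r, hxr, hr⟩ := exists_between hx
  have hr0 : 0 ≤ r := (abs_nonneg x).trans hxr.le
  have hu : Summable fun n : ℕ => ((n : ℝ) + 1) * (n * r ^ (n - 1)) := by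
    rw [← summable_nat_add_iff 1]
    have hn : ‖r‖ < 1 := by rwa [Real.norm_eq_abs, abs_of_nonneg hr0]
    have h2 := summable_pow_mul_geometric_of_norm_lt_one 2 hn
    have h1 := summable_pow_mul_geometric_of_norm_lt_one 1 hn
    have h0 := summable_geometric_of_lt_one hr0 hr
    refine (h2.add ((h1.mul_left 3).add (h0.mul_left 2))).congr fun n => ?_
    push_cast
    ring
  have hmem : x ∈ Metric.ball (0 : ℝ) r := by simpa using hxr
  have hbd : ∀ (n : ℕ) (y : ℝ), y ∈ Metric.ball (0 : ℝ) r →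
      ‖c n * (n * y ^ (n - 1))‖ ≤ ((n : ℝ) + 1) * (n * r ^ (n - 1)) := by
    intro n y hy
    have hy' : |y| ≤ r := by
      have : |y| < r := by simpa using hy
      exact this.le
    rw [norm_mul, norm_mul, norm_pow, Real.norm_eq_abs, Real.norm_eq_abs, Real.norm_eq_abs,
      Nat.abs_cast]
    have := hc n
    gcongr
  have h := hasDerivAt_tsum_of_isPreconnected (g := fun n y => c n * y ^ n)
    (g' := fun n y => c n * (n * y ^ (n - 1))) hu Metric.isOpen_ball
    (convex_ball (0 : ℝ) r).isPreconnected
    (fun n y _ => (hasDerivAt_pow n y).const_mul (c n)) hbd hmem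
    (summable_powerSeries_of_abs_le hc hx) hmem
  refine h.congr_deriv ?_
  have hs : Summable fun n : ℕ => c n * (n * x ^ (n - 1)) :=
    Summable.of_norm_bounded hu fun n => hbd n x hmem
  rw [hs.tsum_eq_zero_add]
  simp only [Nat.cast_zero, zero_mul, mul_zero, zero_add]
  refine tsum_congr fun n => ?_
  push_cast
  ring

/-- The function `2 K(k) / π` in the parameter `x = k^2`. -/
noncomputable def ellA (x : ℝ) : ℝ := ∑' n, ellCoeff n * x ^ n

/-- The derivative of `ellA`. -/
noncomputable def ellA' (x : ℝ) : ℝ := ∑' n : ℕ, ((n : ℝ) + 1) * ellCoeff (n + 1) * x ^ n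

/-- The function `x (1 - x) ellA' x`. -/
noncomputable def ellD (x : ℝ) : ℝ := x * (1 - x) * ellA' x

/-- The power series coefficients of `ellD`. -/
noncomputable def ellDCoeff : ℕ → ℝ
  | 0 => 0
  | n + 1 => ((n : ℝ) + 1) * ellCoeff (n + 1) - n * ellCoeff n

lemma abs_ellCoeff_le (n : ℕ) : |ellCoeff n| ≤ n + 1 := by
  rw [abs_of_nonneg (ellCoeff_nonneg n)]
  have : (0 : ℝ) ≤ n := n.cast_nonneg
  linarith [ellCoeff_le_one n]

lemma abs_ellDCoeff_le (n : ℕ) : |ellDCoeff n| ≤ n + 1 := by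
  cases n with
  | zero => simp [ellDCoeff]
  | succ n =>
    have hn : (0 : ℝ) ≤ n := n.cast_nonneg
    have h1 := ellCoeff_le_one n
    have h2 := ellCoeff_le_one (n + 1)
    have h3 := ellCoeff_nonneg n
    have h4 := ellCoeff_nonneg (n + 1)
    rw [ellDCoeff, abs_le]
    push_cast
    constructor <;> nlinarith

lemma hasDerivAt_ellA {x : ℝ} (hx : |x| < 1) : HasDerivAt ellA (ellA' x) x :=
  hasDerivAt_powerSeries_of_abs_le abs_ellCoeff_le hx

lemma ellD_eq_tsum {x : ℝ} (hx : |x| < 1) : ellD x = ∑' n, ellDCoeff n * x ^ n := by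
  have hbd : ∀ n : ℕ, |(n : ℝ) * ellCoeff n| ≤ n + 1 := fun n => by
    rw [abs_of_nonneg (mul_nonneg n.cast_nonneg (ellCoeff_nonneg n))]
    nlinarith [ellCoeff_le_one n, (n.cast_nonneg : (0 : ℝ) ≤ n)]
  have hs := summable_powerSeries_of_abs_le hbd hx
  have e1 : x * ellA' x = ∑' n : ℕ, (n : ℝ) * ellCoeff n * x ^ n := by
    rw [hs.tsum_eq_zero_add, ellA', ← tsum_mul_left]
    simp only [Nat.cast_zero, zero_mul, zero_add]
    refine tsum_congr fun n => ?_
    push_cast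
    ring
  have hs1 := (summable_nat_add_iff 1).2 hs
  rw [(summable_powerSeries_of_abs_le abs_ellDCoeff_le hx).tsum_eq_zero_add]
  calc ellD x = x * ellA' x - x * (x * ellA' x) := by rw [ellD]; ring
    _ = (∑' n : ℕ, ((n + 1 : ℕ) : ℝ) * ellCoeff (n + 1) * x ^ (n + 1))
        - ∑' n : ℕ, x * ((n : ℝ) * ellCoeff n * x ^ n) := by
      rw [e1, tsum_mul_left, hs.tsum_eq_zero_add]
      simp
    _ = _ := by
      rw [← hs1.tsum_sub (hs.mul_left x)]
      simp only [ellDCoeff, zero_mul, zero_add]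
      refine tsum_congr fun n => ?_
      push_cast
      ring

lemma hasDerivAt_ellD {x : ℝ} (hx : |x| < 1) : HasDerivAt ellD (ellA x / 4) x := by
  have h := hasDerivAt_powerSeries_of_abs_le abs_ellDCoeff_le hx
  have e : ellD =ᶠ[nhds x] fun y => ∑' n, ellDCoeff n * y ^ n := by
    filter_upwards [continuous_abs.continuousAt.eventually_lt continuousAt_const hx] with y hy
    exact ellD_eq_tsum hy
  refine (h.congr_of_eventuallyEq e).congr_deriv ?_
  rw [ellA, ← tsum_div_const]
  refine tsum_congr fun n => ?_
  simp only [ellDCoeff]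
  linear_combination x ^ n * ellCoeff_succ n

lemma sum_range_ellDCoeff (n : ℕ) :
    ∑ i ∈ Finset.range (n + 1), ellDCoeff i = n * ellCoeff n := by
  induction n with
  | zero => simp [ellDCoeff]
  | succ n ih => rw [Finset.sum_range_succ, ih, ellDCoeff]; push_cast; ring

lemma tendsto_ellD : Tendsto ellD (nhdsWithin 1 (Set.Iio 1)) (nhds (1 / π)) := by
  have h : Tendsto (fun n => ∑ i ∈ Finset.range n, ellDCoeff i) atTop (nhds (1 / π)) := by
    rw [← tendsto_add_atTop_iff_nat 1]
    simpa only [sum_range_ellDCoeff] using tendsto_mul_ellCoeff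
  refine (tendsto_tsum_powerSeries_nhdsWithin_lt h).congr' ?_
  have : Set.Ioo (-1 : ℝ) 1 ∈ nhdsWithin (1 : ℝ) (Set.Iio 1) :=
    Ioo_mem_nhdsLT (by norm_num)
  filter_upwards [this] with x hx
  exact (ellD_eq_tsum (abs_lt.2 hx)).symm

lemma tendsto_one_sub_mul_ellA :
    Tendsto (fun x => (1 - x) * ellA x) (nhdsWithin 1 (Set.Iio 1)) (nhds 0) := by
  let e : ℕ → ℝ := fun n => ellCoeff n - if n = 0 then 0 else ellCoeff (n - 1)
  have hsum : ∀ n, ∑ i ∈ Finset.range (n + 1), e i = ellCoeff n := by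
    intro n
    induction n with
    | zero => simp [e]
    | succ n ih => rw [Finset.sum_range_succ, ih]; simp [e]
  have h : Tendsto (fun n => ∑ i ∈ Finset.range n, e i) atTop (nhds 0) := by
    rw [← tendsto_add_atTop_iff_nat 1]
    simpa only [hsum] using tendsto_ellCoeff
  refine (tendsto_tsum_powerSeries_nhdsWithin_lt h).congr' ?_
  have : Set.Ioo (-1 : ℝ) 1 ∈ nhdsWithin (1 : ℝ) (Set.Iio 1) :=
    Ioo_mem_nhdsLT (by norm_num)
  filter_upwards [this] with x hx
  have hs := summable_powerSeries_of_abs_le abs_ellCoeff_le (abs_lt.2 hx)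
  have hs1 := (summable_nat_add_iff 1).2 hs
  have he : Summable fun n => e (n + 1) * x ^ (n + 1) := by
    refine (hs1.sub (hs.mul_left x)).congr fun n => ?_
    simp only [e, Nat.add_eq_zero_iff, one_ne_zero, and_false, if_false, Nat.add_sub_cancel]
    ring
  rw [((summable_nat_add_iff (f := fun n => e n * x ^ n) 1).1 he).tsum_eq_zero_add]
  calc e 0 * x ^ 0 + ∑' n, e (n + 1) * x ^ (n + 1)
      = ellCoeff 0 * x ^ 0 + ((∑' n, ellCoeff (n + 1) * x ^ (n + 1))
          - ∑' n, x * (ellCoeff n * x ^ n)) := by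
        rw [← hs1.tsum_sub (hs.mul_left x)]
        congr 1
        · simp [e]
        · refine tsum_congr fun n => ?_
          simp only [e, Nat.add_eq_zero_iff, one_ne_zero, and_false, if_false,
            Nat.add_sub_cancel]
          ring
    _ = (1 - x) * ellA x := by
        rw [tsum_mul_left, ← add_sub_assoc, ← hs.tsum_eq_zero_add, ellA]; ring

lemma one_le_ellA {x : ℝ} (h0 : 0 ≤ x) (h1 : x < 1) : 1 ≤ ellA x := by
  have hs := summable_powerSeries_of_abs_le abs_ellCoeff_le (abs_lt.2 ⟨by linarith, h1⟩)
  have h := hs.le_tsum 0 fun n _ => mul_nonneg (ellCoeff_nonneg n) (pow_nonneg h0 n)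
  rwa [ellCoeff_zero, pow_zero, mul_one] at h

lemma ellA_mono {x y : ℝ} (h0 : 0 ≤ x) (hxy : x ≤ y) (h1 : y < 1) : ellA x ≤ ellA y := by
  have hx := summable_powerSeries_of_abs_le abs_ellCoeff_le
    (abs_lt.2 ⟨by linarith, hxy.trans_lt h1⟩)
  have hy := summable_powerSeries_of_abs_le abs_ellCoeff_le
    (abs_lt.2 ⟨by linarith, h1⟩ : |y| < 1)
  exact hx.tsum_le_tsum
    (fun n => mul_le_mul_of_nonneg_left (pow_le_pow_left₀ h0 hxy n) (ellCoeff_nonneg n)) hy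

lemma hasDerivAt_landen {t : ℝ} (ht : 1 + t ≠ 0) :
    HasDerivAt (fun t : ℝ => ((1 - t) / (1 + t)) ^ 2) (-4 * (1 - t) / (1 + t) ^ 3) t := by
  have h := ((((hasDerivAt_id t).const_sub 1).div ((hasDerivAt_id t).const_add 1) ht).pow 2)
  refine h.congr_deriv ?_
  simp only [id, Pi.div_apply, Nat.add_one_sub_one, pow_one, Nat.cast_ofNat]
  field_simp
  ring

/-- The Wronskian form of Legendre's relation, with one of the two periods replaced by its
Landen transform. -/
noncomputable def legendreWronskian (t : ℝ) : ℝ :=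
  ellA (t ^ 2) * (-(1 + t) * ellD (((1 - t) / (1 + t)) ^ 2)
    - t * (1 - t) / (1 + t) * ellA (((1 - t) / (1 + t)) ^ 2))
  - ellA (((1 - t) / (1 + t)) ^ 2) / (1 + t) * (2 * ellD (t ^ 2))

lemma landen_mem_Ioo {t : ℝ} (h0 : 0 < t) (h1 : t < 1) :
    ((1 - t) / (1 + t)) ^ 2 ∈ Set.Ioo (0 : ℝ) 1 := by
  have h2 : 0 < (1 - t) / (1 + t) := div_pos (by linarith) (by linarith)
  have h3 : (1 - t) / (1 + t) < 1 := by rw [div_lt_one (by linarith)]; linarith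
  exact ⟨by positivity, by nlinarith⟩

lemma hasDerivAt_legendreWronskian {t : ℝ} (h0 : 0 < t) (h1 : t < 1) :
    HasDerivAt legendreWronskian 0 t := by
  have ht : 1 + t ≠ 0 := by linarith
  have hX := landen_mem_Ioo h0 h1
  have hX' : |((1 - t) / (1 + t)) ^ 2| < 1 := abs_lt.2 ⟨by linarith [hX.1], hX.2⟩
  have hY' : |t ^ 2| < 1 := abs_lt.2 ⟨by nlinarith, by nlinarith⟩
  have dX := hasDerivAt_landen ht
  have dY := hasDerivAt_pow 2 t
  have dAX := (hasDerivAt_ellA hX').comp t dX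
  have dAY := HasDerivAt.comp (h := fun t : ℝ => t ^ 2) t (hasDerivAt_ellA hY') dY
  have dDX := (hasDerivAt_ellD hX').comp t dX
  have dDY := HasDerivAt.comp (h := fun t : ℝ => t ^ 2) t (hasDerivAt_ellD hY') dY
  have d1 := (hasDerivAt_id t).const_add 1
  have dq := ((hasDerivAt_id t).mul ((hasDerivAt_id t).const_sub 1)).div d1 ht
  have h := (dAY.mul ((d1.neg.mul dDX).sub (dq.mul dAX))).sub
    ((dAX.div d1 ht).mul (dDY.const_mul 2))
  refine h.congr_deriv ?_
  simp only [id, Pi.mul_apply, Pi.div_apply, Pi.sub_apply, Pi.neg_apply, Function.comp_apply, ellD]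
  field_simp
  ring

lemma tendsto_legendreWronskian :
    Tendsto legendreWronskian (nhdsWithin 0 (Set.Ioi 0)) (nhds (-(1 / π))) := by
  have hid : Tendsto (fun t : ℝ => t) (nhdsWithin 0 (Set.Ioi 0)) (nhds 0) :=
    tendsto_nhdsWithin_of_tendsto_nhds tendsto_id
  have hX : Tendsto (fun t : ℝ => ((1 - t) / (1 + t)) ^ 2) (nhdsWithin 0 (Set.Ioi 0))
      (nhdsWithin 1 (Set.Iio 1)) := by
    refine tendsto_nhdsWithin_of_tendsto_nhds_of_eventually_within _ ?_ ?_
    · have := ((hid.const_sub 1).div (hid.const_add 1) (by norm_num)).pow 2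
      simpa using this
    · filter_upwards [Ioo_mem_nhdsGT (zero_lt_one' ℝ)] with t ht
      exact (landen_mem_Ioo ht.1 ht.2).2
  have hD := tendsto_ellD.comp hX
  have hA : Tendsto (fun t => t * ellA (((1 - t) / (1 + t)) ^ 2)) (nhdsWithin 0 (Set.Ioi 0))
      (nhds 0) := by
    have h := (tendsto_one_sub_mul_ellA.comp hX).mul (((hid.const_add 1).pow 2).div_const 4)
    rw [zero_mul] at h
    refine h.congr' ?_
    filter_upwards [self_mem_nhdsWithin] with t ht
    have : 1 + t ≠ 0 := by linarith [Set.mem_Ioi.1 ht]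
    simp only [Function.comp_apply]
    field_simp
    ring
  have h00 : |(0 : ℝ)| < 1 := by norm_num
  have hsq : Tendsto (fun t : ℝ => t ^ 2) (nhdsWithin 0 (Set.Ioi 0)) (nhds 0) := by
    simpa using hid.pow 2
  have hA0 : Tendsto (fun t : ℝ => ellA (t ^ 2)) (nhdsWithin 0 (Set.Ioi 0)) (nhds 1) := by
    have h := (hasDerivAt_ellA h00).continuousAt.tendsto.comp hsq
    have e : ellA 0 = 1 := by
      rw [ellA, tsum_eq_single 0 fun n hn => by simp [hn]]; simp [ellCoeff_zero]
    rwa [e] at h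
  have hD0 : Tendsto (fun t : ℝ => ellD (t ^ 2) / t) (nhdsWithin 0 (Set.Ioi 0)) (nhds 0) := by
    have h := ((hasDerivAt_ellD h00).tendsto_slope_zero_right).comp
      (tendsto_nhdsWithin_of_tendsto_nhds_of_eventually_within _ hsq
        (by filter_upwards [self_mem_nhdsWithin] with t ht using pow_pos (Set.mem_Ioi.1 ht) 2))
    have h' := h.mul hid
    rw [mul_zero] at h'
    refine h'.congr' ?_
    filter_upwards [self_mem_nhdsWithin] with t ht
    have : t ≠ 0 := (Set.mem_Ioi.1 ht).ne'
    have e : ellD 0 = 0 := by simp [ellD]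
    simp only [Function.comp_apply, zero_add, e, sub_zero, smul_eq_mul]
    field_simp
  have hi : Tendsto (fun t : ℝ => (1 - t) / (1 + t)) (nhdsWithin 0 (Set.Ioi 0)) (nhds 1) := by
    have h := (hid.const_sub 1).div (hid.const_add 1) (by norm_num)
    rwa [sub_zero, add_zero, div_one] at h
  have hi2 : Tendsto (fun t : ℝ => 2 / (1 + t)) (nhdsWithin 0 (Set.Ioi 0)) (nhds 2) := by
    have h := (tendsto_const_nhds (x := (2 : ℝ))).div (hid.const_add 1) (by norm_num)
    rwa [add_zero, div_one] at h
  have h := (hA0.mul (((hid.const_add 1).neg.mul hD).sub (hi.mul hA))).sub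
    ((hA.mul hi2).mul hD0)
  have e : (1 : ℝ) * (-(1 + 0) * (1 / π) - 1 * 0) - 0 * 2 * 0 = -(1 / π) := by ring
  rw [e] at h
  refine h.congr' ?_
  filter_upwards [self_mem_nhdsWithin] with t ht
  have h1 : t ≠ 0 := (Set.mem_Ioi.1 ht).ne'
  have h2 : 1 + t ≠ 0 := by linarith [Set.mem_Ioi.1 ht]
  simp only [Function.comp_apply, legendreWronskian]
  field_simp

lemma legendreWronskian_eq {t : ℝ} (h0 : 0 < t) (h1 : t < 1) :
    legendreWronskian t = -(1 / π) := by
  refine tendsto_nhds_unique_of_eventuallyEq tendsto_const_nhds tendsto_legendreWronskian ?_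
  filter_upwards [Ioo_mem_nhdsGT (zero_lt_one' ℝ)] with s hs
  exact isOpen_Ioo.is_const_of_deriv_eq_zero isPreconnected_Ioo
    (fun x hx => (hasDerivAt_legendreWronskian hx.1 hx.2).differentiableAt.differentiableWithinAt)
    (fun x hx => (hasDerivAt_legendreWronskian hx.1 hx.2).deriv) ⟨h0, h1⟩ hs

lemma legendre_relation_one_ninth_one_fourth :
    3 / 2 * (ellA (1 / 4) * ellD (1 / 9)) + 1 / 6 * (ellA (1 / 4) * ellA (1 / 9))
      + 4 / 3 * (ellA (1 / 9) * ellD (1 / 4)) = 1 / π := by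
  have h := legendreWronskian_eq (t := 1 / 2) (by norm_num) (by norm_num)
  rw [legendreWronskian] at h
  norm_num at h ⊢
  linarith

/-- A sequence of approximate solutions of the hypergeometric equation
`(x (1 - x) f')' = f / 4` that are regular at `0` converges to a multiple of `ellA`. -/
lemma tendsto_of_approx_hypergeometric {x₀ c : ℝ} (hx₀ : 0 < x₀) (hx₁ : x₀ < 1)
    {f f' g ε : ℕ → ℝ → ℝ} {δ : ℕ → ℝ}
    (hf : ∀ n x, HasDerivAt (f n) (f' n x) x)
    (hg : ∀ n x, HasDerivAt (g n) (f n x / 4 - ε n x) x)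
    (hfg : ∀ n x, x * (1 - x) * f' n x = g n x)
    (hε : ∀ n, ∀ x ∈ Set.Icc 0 x₀, |ε n x| ≤ δ n)
    (hδ : Tendsto δ atTop (nhds 0)) (hc : Tendsto (fun n => f n 0) atTop (nhds c)) :
    Tendsto (fun n => f n x₀) atTop (nhds (c * ellA x₀)) ∧
      Tendsto (fun n => g n x₀) atTop (nhds (c * ellD x₀)) := by
  have habs : ∀ x ∈ Set.Icc 0 x₀, |x| < 1 := fun x hx =>
    abs_lt.2 ⟨by linarith [hx.1], by linarith [hx.2]⟩
  have hA1 : ∀ x ∈ Set.Icc 0 x₀, 1 ≤ ellA x := fun x hx =>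
    one_le_ellA hx.1 (by linarith [hx.2])
  have hAM : ∀ x ∈ Set.Icc 0 x₀, ellA x ≤ ellA x₀ := fun x hx => ellA_mono hx.1 hx.2 hx₁
  set M := ellA x₀ with hM
  have hM1 : 1 ≤ M := hA1 x₀ ⟨hx₀.le, le_rfl⟩
  have hδ0 : ∀ n, 0 ≤ δ n := fun n => (abs_nonneg _).trans (hε n 0 ⟨le_rfl, hx₀.le⟩)
  let W : ℕ → ℝ → ℝ := fun n x => g n x * ellA x - f n x * ellD x
  have hW' : ∀ n, ∀ x ∈ Set.Icc 0 x₀, HasDerivAt (W n) (-(ε n x * ellA x)) x := by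
    intro n x hx
    refine (((hg n x).mul (hasDerivAt_ellA (habs x hx))).sub
      ((hf n x).mul (hasDerivAt_ellD (habs x hx)))).congr_deriv ?_
    rw [← hfg, ellD]
    ring
  have hW0 : ∀ n, W n 0 = 0 := fun n => by simp [W, ← hfg, ellD]
  have hWle : ∀ n, ∀ x ∈ Set.Icc 0 x₀, |W n x| ≤ δ n * M * x := by
    intro n x hx
    rcases hx.1.eq_or_lt with h | h
    · rw [← h, hW0]; simp
    have hsub : ∀ y ∈ Set.Icc 0 x, y ∈ Set.Icc 0 x₀ := fun y hy => ⟨hy.1, hy.2.trans hx.2⟩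
    obtain ⟨y, hy, hy'⟩ := exists_hasDerivAt_eq_slope (W n) (fun y => -(ε n y * ellA y)) h
      (fun y hy => (hW' n y (hsub y hy)).continuousAt.continuousWithinAt)
      (fun y hy => hW' n y (hsub y ⟨hy.1.le, hy.2.le⟩))
    have hyI := hsub y ⟨hy.1.le, hy.2.le⟩
    rw [hW0, sub_zero, sub_zero, eq_div_iff h.ne'] at hy'
    have hA0 : 0 ≤ ellA y := by linarith [hA1 y hyI]
    rw [← hy', abs_mul, abs_neg, abs_mul, abs_of_pos h, abs_of_nonneg hA0]
    have := hε n y hyI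
    have := hAM y hyI
    have := hδ0 n
    gcongr
  have hquot : ∀ n, |f n x₀ / M - f n 0| ≤ δ n * (M / (1 - x₀) * x₀) := by
    intro n
    have hne : ∀ y ∈ Set.Icc 0 x₀, ellA y ≠ 0 := fun y hy => by linarith [hA1 y hy]
    have hd : ∀ y ∈ Set.Icc 0 x₀, HasDerivAt (fun y => f n y / ellA y)
        ((f' n y * ellA y - f n y * ellA' y) / ellA y ^ 2) y := fun y hy =>
      (hf n y).div (hasDerivAt_ellA (habs y hy)) (hne y hy)
    obtain ⟨y, hy, hy'⟩ := exists_hasDerivAt_eq_slope (fun y => f n y / ellA y) _ hx₀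
      (fun y hy => (hd y hy).continuousAt.continuousWithinAt)
      (fun y hy => hd y ⟨hy.1.le, hy.2.le⟩)
    have hyI : y ∈ Set.Icc 0 x₀ := ⟨hy.1.le, hy.2.le⟩
    have e0 : ellA 0 = 1 := by
      rw [ellA, tsum_eq_single 0 fun n hn => by simp [hn]]; simp [ellCoeff_zero]
    rw [sub_zero, eq_div_iff hx₀.ne', e0, div_one] at hy'
    have hy1 : 0 < 1 - y := by linarith [hy.2]
    have hkey : f' n y * ellA y - f n y * ellA' y = W n y / (y * (1 - y)) := by
      have := hy.1.ne'
      simp only [W, ← hfg, ellD]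
      field_simp
    have hb : |W n y / (y * (1 - y))| ≤ δ n * (M / (1 - x₀)) := by
      have hpos : 0 < y * (1 - y) := mul_pos hy.1 hy1
      rw [abs_div, abs_of_pos hpos, div_le_iff₀ hpos]
      refine (hWle n y hyI).trans ?_
      have h3 : 1 ≤ (1 - y) / (1 - x₀) := by
        rw [le_div_iff₀ (by linarith)]; linarith [hy.2]
      calc δ n * M * y = δ n * M * y * 1 := (mul_one _).symm
        _ ≤ δ n * M * y * ((1 - y) / (1 - x₀)) := by
          have := hδ0 n
          have := hy.1.le
          gcongr
        _ = _ := by ring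
    rw [← hM] at hy'
    rw [← hy', hkey, abs_mul, abs_of_pos hx₀, abs_div, abs_of_nonneg (sq_nonneg (ellA y)),
      ← mul_assoc]
    gcongr
    refine (div_le_self (abs_nonneg _) ?_).trans hb
    nlinarith [hA1 y hyI]
  have hM0 : M ≠ 0 := by linarith
  have hF : Tendsto (fun n => f n x₀) atTop (nhds (c * M)) := by
    have h1 : Tendsto (fun n => f n x₀ / M - f n 0) atTop (nhds 0) :=
      squeeze_zero_norm hquot (by simpa using hδ.mul_const (M / (1 - x₀) * x₀))
    have h2 := (h1.add hc).mul_const M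
    rw [zero_add] at h2
    refine h2.congr fun n => ?_
    field_simp
    ring
  refine ⟨hF, ?_⟩
  have h1 : Tendsto (fun n => W n x₀) atTop (nhds 0) :=
    squeeze_zero_norm (fun n => hWle n x₀ ⟨hx₀.le, le_rfl⟩)
      (by simpa using (hδ.mul_const M).mul_const x₀)
  have h2 := (h1.add (hF.mul_const (ellD x₀))).div_const M
  have e : (0 + c * M * ellD x₀) / M = c * ellD x₀ := by field_simp; ring
  rw [e] at h2
  refine h2.congr fun n => ?_
  simp only [W, ← hM]
  field_simp
  ring

/-- The coefficient of `u^i v^j` in Appell's series `F₄(1/2, 1/2; 1, 1; u, v)`. -/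
noncomputable def appellCoeff (i j : ℕ) : ℝ := ellCoeff (i + j) * ((i + j).choose i : ℝ) ^ 2

lemma appellCoeff_nonneg (i j : ℕ) : 0 ≤ appellCoeff i j :=
  mul_nonneg (ellCoeff_nonneg _) (sq_nonneg _)

lemma appellCoeff_comm (i j : ℕ) : appellCoeff i j = appellCoeff j i := by
  rw [appellCoeff, appellCoeff, add_comm j i, ← Nat.choose_symm_add]

lemma appellCoeff_succ_left (i j : ℕ) :
    ((i : ℝ) + 1) ^ 2 * appellCoeff (i + 1) j = ((i : ℝ) + j + 1 / 2) ^ 2 * appellCoeff i j := by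
  have h : ((i : ℝ) + j + 1) * (i + j).choose i = (i + j + 1).choose (i + 1) * (i + 1) := by
    exact_mod_cast Nat.add_one_mul_choose_eq (i + j) i
  have h2 := ellCoeff_succ (i + j)
  push_cast at h2
  rw [appellCoeff, appellCoeff, add_right_comm]
  calc ((i : ℝ) + 1) ^ 2 * (ellCoeff (i + j + 1) * ((i + j + 1).choose (i + 1) : ℝ) ^ 2)
      = ellCoeff (i + j + 1) * ((i + j + 1).choose (i + 1) * ((i : ℝ) + 1)) ^ 2 := by ring
    _ = (((i : ℝ) + j + 1) ^ 2 * ellCoeff (i + j + 1)) * ((i + j).choose i : ℝ) ^ 2 := by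
      rw [← h]; ring
    _ = _ := by rw [h2]; ring

lemma appellCoeff_succ_right (i j : ℕ) :
    ((j : ℝ) + 1) ^ 2 * appellCoeff i (j + 1) = ((i : ℝ) + j + 1 / 2) ^ 2 * appellCoeff i j := by
  rw [appellCoeff_comm i (j + 1), appellCoeff_succ_left, appellCoeff_comm j i, add_comm (j : ℝ)]

/-- The homogeneous component of degree `n` of Appell's series `F₄(1/2, 1/2; 1, 1; u, v)`, with
its terms weighted by `q`. -/
noncomputable def appellPart (q : ℕ → ℕ → ℝ) (n : ℕ) (u v : ℝ) : ℝ :=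
  ∑ p ∈ Finset.HasAntidiagonal.antidiagonal n,
    q p.1 p.2 * (appellCoeff p.1 p.2 * u ^ p.1 * v ^ p.2)

lemma appellPart_swap (q : ℕ → ℕ → ℝ) (n : ℕ) (u v : ℝ) :
    appellPart q n u v = appellPart (fun i j => q j i) n v u := by
  rw [appellPart, appellPart, ← Finset.Nat.sum_antidiagonal_swap]
  refine Finset.sum_congr rfl fun p _ => ?_
  simp only [Prod.fst_swap, Prod.snd_swap]
  rw [appellCoeff_comm p.2 p.1]
  ring

lemma appellPart_succ_left (r : ℕ → ℕ → ℝ) (n : ℕ) (u v : ℝ) :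
    appellPart (fun i j => (i : ℝ) ^ 2 * r i j) (n + 1) u v =
      appellPart (fun i j => u * ((i : ℝ) + j + 1 / 2) ^ 2 * r (i + 1) j) n u v := by
  rw [appellPart, appellPart, Finset.Nat.sum_antidiagonal_succ]
  simp only [Nat.cast_zero, ne_eq, OfNat.ofNat_ne_zero, not_false_eq_true, zero_pow, zero_mul,
    zero_add]
  refine Finset.sum_congr rfl fun p _ => ?_
  push_cast
  linear_combination r (p.1 + 1) p.2 * u ^ (p.1 + 1) * v ^ p.2 * appellCoeff_succ_left p.1 p.2

lemma appellPart_succ_right (r : ℕ → ℕ → ℝ) (n : ℕ) (u v : ℝ) :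
    appellPart (fun i j => (j : ℝ) ^ 2 * r i j) (n + 1) u v =
      appellPart (fun i j => v * ((i : ℝ) + j + 1 / 2) ^ 2 * r i (j + 1)) n u v := by
  rw [appellPart, appellPart, Finset.Nat.sum_antidiagonal_succ']
  simp only [Nat.cast_zero, ne_eq, OfNat.ofNat_ne_zero, not_false_eq_true, zero_pow, zero_mul,
    zero_add]
  refine Finset.sum_congr rfl fun p _ => ?_
  push_cast
  linear_combination r p.1 (p.2 + 1) * u ^ p.1 * v ^ (p.2 + 1) * appellCoeff_succ_right p.1 p.2

lemma abs_appellPart_le {q : ℕ → ℕ → ℝ} {n : ℕ} {u v s t B : ℝ} (hu : 0 ≤ u) (hv : 0 ≤ v)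
    (hs : 0 ≤ s) (ht : 0 ≤ t) (hus : u ≤ s ^ 2) (hvt : v ≤ t ^ 2)
    (hq : ∀ i j, i + j = n → |q i j| ≤ B) :
    |appellPart q n u v| ≤ B * ((s + t) ^ 2) ^ n := by
  have hB : 0 ≤ B := (abs_nonneg _).trans (hq 0 n (zero_add n))
  calc |appellPart q n u v|
      ≤ ∑ p ∈ Finset.HasAntidiagonal.antidiagonal n,
          |q p.1 p.2 * (appellCoeff p.1 p.2 * u ^ p.1 * v ^ p.2)| :=
        Finset.abs_sum_le_sum_abs _ _
    _ ≤ ∑ p ∈ Finset.HasAntidiagonal.antidiagonal n,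
          B * (n.choose p.1 * (s ^ p.1 * t ^ p.2)) ^ 2 := by
        refine Finset.sum_le_sum fun p hp => ?_
        have hp' := Finset.HasAntidiagonal.mem_antidiagonal.1 hp
        have hc := appellCoeff_nonneg p.1 p.2
        have hc1 : appellCoeff p.1 p.2 ≤ (n.choose p.1 : ℝ) ^ 2 := by
          rw [appellCoeff, hp']
          exact mul_le_of_le_one_left (sq_nonneg _) (ellCoeff_le_one n)
        have h1 : appellCoeff p.1 p.2 * u ^ p.1 * v ^ p.2
            ≤ (n.choose p.1 * (s ^ p.1 * t ^ p.2)) ^ 2 := by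
          calc appellCoeff p.1 p.2 * u ^ p.1 * v ^ p.2
              ≤ (n.choose p.1 : ℝ) ^ 2 * (s ^ 2) ^ p.1 * (t ^ 2) ^ p.2 := by gcongr
            _ = _ := by ring
        rw [abs_mul, abs_of_nonneg (by positivity : 0 ≤ appellCoeff p.1 p.2 * u ^ p.1 * v ^ p.2)]
        exact mul_le_mul (hq _ _ hp') h1 (by positivity) hB
    _ ≤ B * (∑ p ∈ Finset.HasAntidiagonal.antidiagonal n,
          n.choose p.1 * (s ^ p.1 * t ^ p.2)) ^ 2 := by
        rw [← Finset.mul_sum]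
        refine mul_le_mul_of_nonneg_left ?_ hB
        exact Finset.sum_sq_le_sq_sum_of_nonneg fun p _ => by positivity
    _ = B * ((s + t) ^ 2) ^ n := by
        rw [← pow_mul, mul_comm 2 n, pow_mul, (Commute.all s t).add_pow' n]
        simp only [nsmul_eq_mul]

/-- Bailey's factorisation of Appell's `F₄(1/2, 1/2; 1, 1; x (1 - y), y (1 - x))`, together with
its logarithmic derivative with respect to `x`. -/
lemma tendsto_sum_appellPart {x y s t : ℝ} (hx0 : 0 < x) (hx1 : x < 1) (hy0 : 0 ≤ y) (hy1 : y < 1)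
    (hs : 0 ≤ s) (ht : 0 ≤ t) (hxs : x * (1 - y) ≤ s ^ 2) (hyt : y ≤ t ^ 2) (hst : s + t < 1) :
    Tendsto (fun N => ∑ n ∈ Finset.range N,
        appellPart (fun _ _ => 1) n (x * (1 - y)) (y * (1 - x)))
      atTop (nhds (ellA y * ellA x)) ∧
    Tendsto (fun N => ∑ n ∈ Finset.range N,
        appellPart (fun i j => i * (1 - x) - j * x) n (x * (1 - y)) (y * (1 - x)))
      atTop (nhds (ellA y * ellD x)) := by
  let h : ℕ → ℝ → ℝ := fun n z => appellPart (fun _ _ => 1) n (z * (1 - y)) (y * (1 - z))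
  let h' : ℕ → ℝ → ℝ := fun n z => ∑ p ∈ Finset.HasAntidiagonal.antidiagonal n,
    appellCoeff p.1 p.2 * (1 - y) ^ p.1 * y ^ p.2 *
      (p.1 * z ^ (p.1 - 1) * (1 - z) ^ p.2 - p.2 * z ^ p.1 * (1 - z) ^ (p.2 - 1))
  let g : ℕ → ℝ → ℝ := fun n z =>
    appellPart (fun i j => i * (1 - z) - j * z) n (z * (1 - y)) (y * (1 - z))
  let e : ℕ → ℝ → ℝ := fun n z => ((n : ℝ) + 1 / 2) ^ 2 * h n z
  let l : ℕ → ℝ → ℝ := fun n z => ∑ p ∈ Finset.HasAntidiagonal.antidiagonal n,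
    appellCoeff p.1 p.2 * (1 - y) ^ p.1 * y ^ p.2 *
      ((p.1 : ℝ) ^ 2 * z ^ (p.1 - 1) * (1 - z) ^ p.2
        + (p.2 : ℝ) ^ 2 * z ^ p.1 * (1 - z) ^ (p.2 - 1))
  have dpow : ∀ (k : ℕ) (z : ℝ), HasDerivAt (fun z : ℝ => (1 - z) ^ k)
      (-(k * (1 - z) ^ (k - 1))) z := fun k z => by
    refine (((hasDerivAt_id z).const_sub 1).pow k).congr_deriv ?_
    simp only [id]
    ring
  have hh : ∀ n z, HasDerivAt (h n) (h' n z) z := by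
    intro n z
    have key := HasDerivAt.fun_sum (u := Finset.HasAntidiagonal.antidiagonal n) fun p (_ : p ∈ _) =>
      (((hasDerivAt_pow p.1 z).mul (dpow p.2 z)).const_mul
        (appellCoeff p.1 p.2 * (1 - y) ^ p.1 * y ^ p.2))
    refine (key.congr_deriv ?_).congr_of_eventuallyEq (Eventually.of_forall fun w => ?_)
    · refine Finset.sum_congr rfl fun p _ => ?_
      ring
    · refine Finset.sum_congr rfl fun p _ => ?_
      simp only [Pi.mul_apply, mul_pow]
      ring
  have hpred : ∀ (k : ℕ) (z : ℝ), z * (k * z ^ (k - 1)) = k * z ^ k := by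
    intro k z
    cases k with
    | zero => simp
    | succ k => rw [Nat.add_sub_cancel]; ring
  have hg : ∀ n z, z * (1 - z) * h' n z = g n z := by
    intro n z
    simp only [h', g, appellPart, Finset.mul_sum]
    refine Finset.sum_congr rfl fun p _ => ?_
    rw [mul_pow, mul_pow]
    linear_combination appellCoeff p.1 p.2 * (1 - y) ^ p.1 * y ^ p.2 *
      ((1 - z) * (1 - z) ^ p.2 * hpred p.1 z - z * z ^ p.1 * hpred p.2 (1 - z))
  have hgd : ∀ n z, HasDerivAt (g n) (h n z / 4 + l n z - e n z) z := by
    intro n z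
    have key := HasDerivAt.fun_sum (u := Finset.HasAntidiagonal.antidiagonal n) fun p (_ : p ∈ _) =>
      (((((hasDerivAt_pow p.1 z).const_mul (p.1 : ℝ)).mul (dpow (p.2 + 1) z)).sub
        (((hasDerivAt_pow (p.1 + 1) z).const_mul (p.2 : ℝ)).mul (dpow p.2 z))).const_mul
        (appellCoeff p.1 p.2 * (1 - y) ^ p.1 * y ^ p.2))
    refine (key.congr_deriv ?_).congr_of_eventuallyEq (Eventually.of_forall fun w => ?_)
    · simp only [h, e, l, appellPart, Finset.mul_sum, Finset.sum_div, ← Finset.sum_add_distrib,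
        ← Finset.sum_sub_distrib]
      refine Finset.sum_congr rfl fun p hp => ?_
      rw [← Finset.HasAntidiagonal.mem_antidiagonal.1 hp, mul_pow, mul_pow]
      push_cast
      linear_combination appellCoeff p.1 p.2 * (1 - y) ^ p.1 * y ^ p.2 *
        (-(p.1 * (1 - z) ^ p.2 * hpred p.1 z) - p.2 * z ^ p.1 * hpred p.2 (1 - z))
    · refine Finset.sum_congr rfl fun p _ => ?_
      simp only [Pi.mul_apply, Pi.sub_apply, mul_pow]
      ring
  have hl0 : ∀ z, l 0 z = 0 := fun z => by simp [l]
  have hl : ∀ n z, l (n + 1) z = e n z := by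
    intro n z
    simp only [l, e, h, appellPart, mul_add, Finset.sum_add_distrib]
    rw [Finset.Nat.sum_antidiagonal_succ, Finset.Nat.sum_antidiagonal_succ', Finset.mul_sum]
    simp only [Nat.cast_zero, ne_eq, OfNat.ofNat_ne_zero, not_false_eq_true, zero_pow, zero_mul,
      mul_zero, zero_add, Nat.add_sub_cancel, ← Finset.sum_add_distrib]
    refine Finset.sum_congr rfl fun p hp => ?_
    rw [← Finset.HasAntidiagonal.mem_antidiagonal.1 hp, mul_pow, mul_pow]
    push_cast
    linear_combination (1 - y) ^ p.1 * y ^ p.2 * z ^ p.1 * (1 - z) ^ p.2 *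
      ((1 - y) * appellCoeff_succ_left p.1 p.2 + y * appellCoeff_succ_right p.1 p.2)
  have htel : ∀ N z, ∑ n ∈ Finset.range (N + 1), (l n z - e n z) = -e N z := by
    intro N z
    induction N with
    | zero => simp [hl0]
    | succ N ih => rw [Finset.sum_range_succ, ih, hl]; ring
  have hρ0 : 0 ≤ (s + t) ^ 2 := sq_nonneg _
  have hρ1 : (s + t) ^ 2 < 1 := by nlinarith
  have hδ : Tendsto (fun n : ℕ => ((n : ℝ) + 1 / 2) ^ 2 * ((s + t) ^ 2) ^ n) atTop (nhds 0) := by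
    have t2 := tendsto_pow_const_mul_const_pow_of_lt_one 2 hρ0 hρ1
    have t1 := tendsto_pow_const_mul_const_pow_of_lt_one 1 hρ0 hρ1
    have t0 := tendsto_pow_atTop_nhds_zero_of_lt_one hρ0 hρ1
    have := t2.add (t1.add (t0.const_mul (1 / 4)))
    simp only [mul_zero, add_zero] at this
    refine this.congr fun n => ?_
    ring
  have hc : Tendsto (fun N => ∑ n ∈ Finset.range (N + 1), h n 0) atTop (nhds (ellA y)) := by
    refine (tendsto_add_atTop_iff_nat (f := fun N => ∑ n ∈ Finset.range N, h n 0) 1).2 ?_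
    refine (summable_powerSeries_of_abs_le abs_ellCoeff_le
      (abs_lt.2 ⟨by linarith, hy1⟩ : |y| < 1)).hasSum.tendsto_sum_nat.congr fun N => ?_
    refine Finset.sum_congr rfl fun n _ => ?_
    simp only [h, appellPart]
    rw [Finset.sum_eq_single (0, n)]
    · simp [appellCoeff]
    · intro p hp hne
      have : p.1 ≠ 0 := fun h0 => hne (Prod.ext h0 (by
        have := Finset.HasAntidiagonal.mem_antidiagonal.1 hp
        simpa [h0] using this))
      simp [this]
    · simp
  have main := tendsto_of_approx_hypergeometric hx0 hx1
    (f := fun N z => ∑ n ∈ Finset.range (N + 1), h n z)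
    (f' := fun N z => ∑ n ∈ Finset.range (N + 1), h' n z)
    (g := fun N z => ∑ n ∈ Finset.range (N + 1), g n z)
    (ε := e) (δ := fun n => ((n : ℝ) + 1 / 2) ^ 2 * ((s + t) ^ 2) ^ n)
    (fun N z => HasDerivAt.fun_sum fun n _ => hh n z)
    (fun N z => by
      refine (HasDerivAt.fun_sum fun n _ => hgd n z).congr_deriv ?_
      rw [sub_eq_add_neg, ← htel, Finset.sum_div, ← Finset.sum_add_distrib]
      exact Finset.sum_congr rfl fun n _ => by ring)
    (fun N z => by
      rw [Finset.mul_sum]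
      exact Finset.sum_congr rfl fun n _ => hg n z)
    (fun n z hz => by
      have hb := abs_appellPart_le (q := fun _ _ => 1) (n := n) (B := 1)
        (mul_nonneg hz.1 (by linarith : 0 ≤ 1 - y))
        (mul_nonneg hy0 (by linarith [hz.2] : 0 ≤ 1 - z)) hs ht
        ((mul_le_mul_of_nonneg_right hz.2 (by linarith)).trans hxs)
        ((mul_le_of_le_one_right hy0 (by linarith [hz.1])).trans hyt)
        (fun _ _ _ => by simp)
      rw [one_mul] at hb
      rw [abs_mul, abs_of_nonneg (sq_nonneg _)]
      exact mul_le_mul_of_nonneg_left hb (sq_nonneg _))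
    hδ hc
  exact ⟨(tendsto_add_atTop_iff_nat 1).1 main.1, (tendsto_add_atTop_iff_nat 1).1 main.2⟩

lemma choose_sq_mul_legendreP (n : ℕ) :
    ((2 * n).choose n : ℝ) ^ 2 * legendreP n (11 / 5) * (5 / 576) ^ n =
      appellPart (fun _ _ => 1) n (1 / 12) (2 / 9) := by
  rw [legendreP, appellPart, ← Finset.Nat.sum_antidiagonal_swap,
    Finset.Nat.sum_antidiagonal_eq_sum_range_succ_mk]
  simp only [Finset.mul_sum, Finset.sum_mul]
  refine Finset.sum_congr rfl fun j hj => ?_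
  have hj' : j ≤ n := Nat.lt_succ_iff.1 (Finset.mem_range.1 hj)
  obtain ⟨i, rfl⟩ := Nat.exists_eq_add_of_le' hj'
  simp only [Prod.fst_swap, Prod.snd_swap, Nat.add_sub_cancel, appellCoeff, ellCoeff,
    Nat.centralBinom_eq_two_mul_choose]
  have e1 : (1 / 12 : ℝ) ^ i = (1 / 2) ^ i * (11 / 5 - 1) ^ i * (5 / 576) ^ i * (4 ^ i) ^ 2 := by
    rw [← pow_mul, mul_comm i 2, pow_mul, ← mul_pow, ← mul_pow, ← mul_pow]; norm_num
  have e2 : (2 / 9 : ℝ) ^ j = (1 / 2) ^ j * (11 / 5 + 1) ^ j * (5 / 576) ^ j * (4 ^ j) ^ 2 := by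
    rw [← pow_mul, mul_comm j 2, pow_mul, ← mul_pow, ← mul_pow, ← mul_pow]; norm_num
  rw [e1, e2, Nat.choose_symm_add]
  simp only [pow_add, inv_eq_one_div]
  field_simp

/-- Multiplying the general term by the cubic turns it, up to a telescoping term, into the weight
appearing in Legendre's relation. -/
lemma sum_range_appellPart_mul_cubic (N : ℕ) :
    ∑ n ∈ Finset.range N, appellPart (fun _ _ => 1) n (1 / 12) (2 / 9) *
        (14 - 171 * (n : ℝ) - 4452 * (n : ℝ) ^ 2 + 2116 * (n : ℝ) ^ 3) =
      ∑ n ∈ Finset.range N,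
        appellPart (fun i j => 2160 * i + 1800 * j + 360) n (1 / 12) (2 / 9)
      - appellPart (fun i j => (i : ℝ) ^ 2 * (720 + 5904 * i + 16272 * j)
          + (j : ℝ) ^ 2 * (-720 + 14832 * i + 4464 * j)) N (1 / 12) (2 / 9) := by
  have hadd : ∀ (q r : ℕ → ℕ → ℝ) (n : ℕ), appellPart (fun i j => q i j + r i j) n (1 / 12) (2 / 9)
      = appellPart q n (1 / 12) (2 / 9) + appellPart r n (1 / 12) (2 / 9) := by
    intro q r n
    simp only [appellPart, add_mul, Finset.sum_add_distrib]
  induction N with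
  | zero => simp [appellPart]
  | succ N ih =>
    rw [Finset.sum_range_succ, Finset.sum_range_succ, ih, hadd _ _ (N + 1),
      appellPart_succ_left (fun i j => 720 + 5904 * i + 16272 * j),
      appellPart_succ_right (fun i j => -720 + 14832 * i + 4464 * j), sub_add_eq_add_sub,
      sub_eq_sub_iff_add_eq_add, add_assoc, add_assoc, add_right_inj]
    simp only [appellPart, Finset.sum_mul, ← Finset.sum_add_distrib]
    refine Finset.sum_congr rfl fun p hp => ?_
    rw [← Finset.HasAntidiagonal.mem_antidiagonal.1 hp]
    push_cast
    ring

lemma natCast_sq_le_cube (k : ℕ) : (k : ℝ) ^ 2 ≤ (k : ℝ) ^ 3 := by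
  rcases Nat.eq_zero_or_pos k with rfl | hk
  · simp
  · exact pow_le_pow_right₀ (by exact_mod_cast hk) (by norm_num)

theorem stmt1 :
    Tendsto (fun N => ∑ n ∈ Finset.range N,
      ((2 * n).choose n : ℝ) ^ 2 * legendreP n (11 / 5) * (5 / 576) ^ n *
        (14 - 171 * (n : ℝ) - 4452 * (n : ℝ) ^ 2 + 2116 * (n : ℝ) ^ 3))
      atTop (nhds (2160 / π)) := by
  simp only [choose_sq_mul_legendreP, sum_range_appellPart_mul_cubic]
  obtain ⟨h0, h1⟩ := tendsto_sum_appellPart (x := 1 / 9) (y := 1 / 4) (s := 3 / 10) (t := 1 / 2)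
    (by norm_num) (by norm_num) (by norm_num) (by norm_num) (by norm_num) (by norm_num)
    (by norm_num) (by norm_num) (by norm_num)
  obtain ⟨-, h2⟩ := tendsto_sum_appellPart (x := 1 / 4) (y := 1 / 9) (s := 12 / 25) (t := 1 / 3)
    (by norm_num) (by norm_num) (by norm_num) (by norm_num) (by norm_num) (by norm_num)
    (by norm_num) (by norm_num) (by norm_num)
  simp only [appellPart_swap _ _ (1 / 4 * (1 - 1 / 9) : ℝ)] at h2
  rw [show (1 / 9 * (1 - 1 / 4) : ℝ) = 1 / 12 by norm_num,
    show (1 / 4 * (1 - 1 / 9) : ℝ) = 2 / 9 by norm_num] at h0 h1 h2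
  have hlim := (((h1.const_mul (3 / 2)).add (h0.const_mul (1 / 6))).add
    (h2.const_mul (4 / 3))).const_mul 2160
  rw [legendre_relation_one_ninth_one_fourth, mul_one_div] at hlim
  have hrem : Tendsto (fun N => appellPart (fun i j =>
      (i : ℝ) ^ 2 * (720 + 5904 * i + 16272 * j)
        + (j : ℝ) ^ 2 * (-720 + 14832 * i + 4464 * j)) N (1 / 12) (2 / 9)) atTop (nhds 0) := by
    have hb : ∀ N : ℕ, ‖appellPart (fun i j =>
        (i : ℝ) ^ 2 * (720 + 5904 * i + 16272 * j)
          + (j : ℝ) ^ 2 * (-720 + 14832 * i + 4464 * j)) N (1 / 12) (2 / 9)‖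
        ≤ 40000 * ((N : ℝ) ^ 3 * ((3 / 10 + 1 / 2 : ℝ) ^ 2) ^ N) := by
      intro N
      rw [← mul_assoc]
      refine abs_appellPart_le (by norm_num) (by norm_num) (by norm_num) (by norm_num)
        (by norm_num) (by norm_num) fun i j hij => ?_
      have hi : (i : ℝ) ^ 2 ≤ (i : ℝ) ^ 3 := natCast_sq_le_cube i
      have hj : (j : ℝ) ^ 2 ≤ (j : ℝ) ^ 3 := natCast_sq_le_cube j
      have h1 : (0 : ℝ) ≤ (i : ℝ) ^ 2 * j := by positivity
      have h2 : (0 : ℝ) ≤ (i : ℝ) * j ^ 2 := by positivity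
      have h3 : (0 : ℝ) ≤ (i : ℝ) ^ 2 := by positivity
      have h4 : (0 : ℝ) ≤ (j : ℝ) ^ 2 := by positivity
      rw [← hij, abs_le]
      push_cast
      constructor <;> nlinarith
    refine squeeze_zero_norm hb ?_
    have := (tendsto_pow_const_mul_const_pow_of_lt_one 3 (r := (3 / 10 + 1 / 2 : ℝ) ^ 2)
      (by norm_num) (by norm_num)).const_mul 40000
    rwa [mul_zero] at this
  have := hlim.sub hrem
  rw [sub_zero] at this
  refine this.congr fun N => ?_
  congr 1
  simp only [Finset.mul_sum, ← Finset.sum_add_distrib]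
  refine Finset.sum_congr rfl fun n _ => ?_
  simp only [appellPart, Finset.mul_sum, ← Finset.sum_add_distrib]
  refine Finset.sum_congr rfl fun p _ => ?_
  ring
end
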